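/- Let ρ_n → 0 be a sparsity sequence satisfying ρ_n n = ω(log n), and let F be a distribution on ℝ^d such that for all suitably large n, ρ_n xᵀy ∈ [0,1] for all x, y ∈ supp F, with E X₁X₁ᵀ of full rank. Let X₁,…,Xₙ be i.i.d. from F and, conditional on X, generate the symmetric adjacency matrix A with independent entries A_{ij} ~ Bernoulli(ρ_n XᵢᵀXⱼ) for i < j. Let X̂ = ASE(A,d). Then with probability at least 1 − Cn^{-2} there exists an orthogonal matrix Q ∈ ℝ^{d×d} such that ‖X̂Q − √ρ_n X‖_{2,∞} ≤ C log n / √(ρ_n n). -/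

import Mathlib

open MeasureTheory Filter Matrix
open scoped BigOperators NNReal ENNReal Topology Classical

noncomputable section

/-- Dot product on `Fin d → ℝ`. -/
def dotd {d : ℕ} (x y : Fin d → ℝ) : ℝ := ∑ k, x k * y k

/-- Euclidean norm on `Fin d → ℝ`. -/
def euclNorm {d : ℕ} (x : Fin d → ℝ) : ℝ := Real.sqrt (∑ k, (x k) ^ 2)

/-- Support of a measure on a topological space. -/
def msupport {α : Type*} [TopologicalSpace α] [MeasurableSpace α] (μ : Measure α) : Set α :=
  {x | ∀ U : Set α, IsOpen U → x ∈ U → 0 < μ U}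

/-- `F` is a `d`-dimensional inner product distribution. -/
def InnerProductDistribution (d : ℕ) (F : Measure (Fin d → ℝ)) : Prop :=
  IsProbabilityMeasure F ∧
    ∀ x ∈ msupport F, ∀ y ∈ msupport F, 0 ≤ dotd x y ∧ dotd x y ≤ 1

/-- Auxiliary i.i.d. uniform randomness on `[0,1]`, indexed by pairs of vertices. -/
def pairUniform (n : ℕ) : Measure ((Fin n × Fin n) → ℝ) :=
  Measure.pi fun _ => volume.restrict (Set.Icc (0:ℝ) 1)

/-- The adjacency matrix built from latent positions `X`, sparsity scale `ρ`, and auxiliary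
uniform variables `u`: conditional on `X`, the entries above the diagonal are independent
`Bernoulli(ρ ⟨X i, X j⟩)`, and the matrix is symmetric and hollow. -/
def adjOf {d n : ℕ} (ρ : ℝ) (X : Fin n → Fin d → ℝ) (u : (Fin n × Fin n) → ℝ) :
    Fin n → Fin n → ℝ := fun i j =>
  if i = j then 0 else if u (min i j, max i j) < ρ * dotd (X i) (X j) then 1 else 0

/-- The joint law of `(A, X)` for a (possibly sparse) random dot product graph whose latent
positions have joint law `μX`. -/
def rdpgLawOf {d n : ℕ} (ρ : ℝ) (μX : Measure (Fin n → Fin d → ℝ)) :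
    Measure ((Fin n → Fin n → ℝ) × (Fin n → Fin d → ℝ)) :=
  Measure.map (fun p => (adjOf ρ p.2 p.1, p.2)) ((pairUniform n).prod μX)

/-- The joint law of `(A,X) ~ RDPG(F, n)`. -/
def rdpgLaw (d n : ℕ) (F : Measure (Fin d → ℝ)) [SigmaFinite F] :
    Measure ((Fin n → Fin n → ℝ) × (Fin n → Fin d → ℝ)) :=
  rdpgLawOf 1 (Measure.pi fun _ : Fin n => F)

/-- `(A, X) ~ RDPG(F, n)` for random variables `A, X` on a probability space `(Ω, P)`. -/
def HasRDPGLaw {Ω : Type*} [MeasurableSpace Ω] (P : Measure Ω) {d n : ℕ}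
    (F : Measure (Fin d → ℝ)) [SigmaFinite F] (A : Ω → Fin n → Fin n → ℝ)
    (X : Ω → Fin n → Fin d → ℝ) : Prop :=
  Measure.map (fun ω => (A ω, X ω)) P = rdpgLaw d n F

/-- The marginal law of the adjacency matrix of an `RDPG(F,n)`. -/
def adjLaw (d n : ℕ) (F : Measure (Fin d → ℝ)) [SigmaFinite F] :
    Measure (Fin n → Fin n → ℝ) :=
  (rdpgLaw d n F).map Prod.fst

/-- The law of the adjacency matrix for fixed latent positions `x`. -/
def adjLawFixed {d : ℕ} (n : ℕ) (x : Fin n → Fin d → ℝ) : Measure (Fin n → Fin n → ℝ) :=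
  Measure.map (fun u => adjOf 1 x u) (pairUniform n)

/-- `Xh` is an adjacency spectral embedding of `A` into dimension `d`: its columns are
orthonormal eigenvectors of `A` corresponding to the `d` largest-in-magnitude eigenvalues,
scaled by the square roots of the absolute eigenvalues. -/
def IsASE {n d : ℕ} (A : Fin n → Fin n → ℝ) (Xh : Fin n → Fin d → ℝ) : Prop :=
  ∃ (lam : Fin d → ℝ) (U : Fin n → Fin d → ℝ),
    (∀ j j', (∑ i, U i j * U i j') = if j = j' then (1:ℝ) else 0) ∧
    (∀ j, (Matrix.of A).mulVec (fun i => U i j) = fun i => lam j * U i j) ∧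
    (∀ (mu : ℝ) (v : Fin n → ℝ), v ≠ 0 → (Matrix.of A).mulVec v = mu • v →
      (∀ j, (∑ i, v i * U i j) = 0) → ∀ j, |mu| ≤ |lam j|) ∧
    (∀ i j, Xh i j = U i j * Real.sqrt |lam j|)

/-- A choice of adjacency spectral embedding of `A` into dimension `d`. -/
def ase (d : ℕ) {n : ℕ} (A : Fin n → Fin n → ℝ) : Fin n → Fin d → ℝ :=
  if h : ∃ Xh, IsASE A Xh then h.choose else 0

/-- The U-statistic with kernel `h` of the points `Y 1, …, Y n`. -/
def Ustat {d : ℕ} (m n : ℕ) (h : (Fin m → Fin d → ℝ) → ℝ) (Y : Fin n → Fin d → ℝ) : ℝ :=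
  ((n.choose m : ℝ))⁻¹ * ∑ c : Fin m → Fin n,
    if StrictMono c then h (fun k => Y (c k)) else 0

/-- The weighted (bootstrapped) U-statistic with kernel `h` and weights `W` (indexed by the
strictly increasing `m`-tuples). -/
def UstatW {d : ℕ} (m n : ℕ) (h : (Fin m → Fin d → ℝ) → ℝ)
    (W : (Fin m → Fin n) → ℝ) (Y : Fin n → Fin d → ℝ) : ℝ :=
  ((n.choose m : ℝ))⁻¹ * ∑ c : Fin m → Fin n,
    if StrictMono c then W c * h (fun k => Y (c k)) else 0

/-- `max_{c ∈ C^n_m} |W c|`. -/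
def maxAbsWeight {m n : ℕ} (W : (Fin m → Fin n) → ℝ) : ℝ :=
  ⨆ c : Fin m → Fin n, if StrictMono c then |W c| else 0

/-- `h` is symmetric in its `m` arguments. -/
def SymmetricKernel {d m : ℕ} (h : (Fin m → Fin d → ℝ) → ℝ) : Prop :=
  ∀ (σ : Equiv.Perm (Fin m)) (x : Fin m → Fin d → ℝ), h (x ∘ σ) = h x

/-- Assumption H1: `h` is invariant under simultaneous orthogonal transformation of
its arguments. -/
def AssumptionH1 {d m : ℕ} (h : (Fin m → Fin d → ℝ) → ℝ) : Prop :=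
  ∀ Q : Matrix (Fin d) (Fin d) ℝ, Qᵀ * Q = 1 →
    ∀ x : Fin m → Fin d → ℝ, h (fun k => Q.mulVec (x k)) = h x

/-- Assumption H2 relative to a set `K₀ ⊆ ℝ^d`: viewing `h` as a function on `ℝ^{md}`,
`h` is twice continuously differentiable on an open neighborhood `S` of `K₀^m` on which its
Hessian is bounded in norm, and the Hessian is continuous on the closure of `K₀^m`. -/
def AssumptionH2On {d m : ℕ} (K₀ : Set (Fin d → ℝ)) (h : (Fin m → Fin d → ℝ) → ℝ) : Prop :=
  ∃ S : Set (Fin m → Fin d → ℝ), IsOpen S ∧ {x | ∀ k, x k ∈ K₀} ⊆ S ∧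
    ContDiffOn ℝ 2 h S ∧
    ContinuousOn (iteratedFDeriv ℝ 2 h) (closure {x | ∀ k, x k ∈ K₀}) ∧
    ∃ C : ℝ, ∀ x ∈ S, ‖iteratedFDeriv ℝ 2 h x‖ ≤ C

/-- Assumption H2 for an RDPG with latent position distribution `F`. -/
def AssumptionH2 {d m : ℕ} (F : Measure (Fin d → ℝ)) (h : (Fin m → Fin d → ℝ) → ℝ) : Prop :=
  AssumptionH2On (msupport F) h

/-- `θ(F) = E h(X₁, …, X_m)` for `X₁, …, X_m` i.i.d. `F`. -/
def thetaOf {d : ℕ} (m : ℕ) (F : Measure (Fin d → ℝ)) [SigmaFinite F]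
    (h : (Fin m → Fin d → ℝ) → ℝ) : ℝ :=
  ∫ x, h x ∂(Measure.pi fun _ : Fin m => F)

/-- The conditional expectation kernel `h₁(z) = E h(z, X₂, …, X_m)`. -/
def kern1 {d : ℕ} (m : ℕ) (hm : 0 < m) (F : Measure (Fin d → ℝ)) [SigmaFinite F]
    (h : (Fin m → Fin d → ℝ) → ℝ) (z : Fin d → ℝ) : ℝ :=
  ∫ x, h (Function.update x (⟨0, hm⟩ : Fin m) z) ∂(Measure.pi fun _ : Fin m => F)

/-- `ζ₁ = E (E[h(X₁,…,X_m) ∣ X₁] − θ)²`. -/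
def zeta1 {d : ℕ} (m : ℕ) (hm : 0 < m) (F : Measure (Fin d → ℝ)) [SigmaFinite F]
    (h : (Fin m → Fin d → ℝ) → ℝ) : ℝ :=
  ∫ z, (kern1 m hm F h z - thetaOf m F h) ^ 2 ∂F

/-- Weak convergence (convergence in distribution) of a sequence of real random variables
`T n` on `(Ω, P)` to the law `μ`, tested against bounded continuous functions. -/
def TendstoInDistribution {Ω : Type*} [MeasurableSpace Ω] (P : Measure Ω)
    (T : ℕ → Ω → ℝ) (μ : Measure ℝ) : Prop :=
  ∀ g : BoundedContinuousFunction ℝ ℝ,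
    Tendsto (fun n => ∫ ω, g (T n ω) ∂P) atTop (𝓝 (∫ x, g x ∂μ))

/-- The uniform distribution on `Fin n`. -/
def uniformFin (n : ℕ) : Measure (Fin n) := ((n : ℝ≥0))⁻¹ • Measure.count

/-- The empirical distribution of the points `Y 1, …, Y n`. -/
def empMeasure {d n : ℕ} (Y : Fin n → Fin d → ℝ) : Measure (Fin d → ℝ) :=
  ((n : ℝ≥0))⁻¹ • ∑ i : Fin n, Measure.dirac (Y i)

instance {d n : ℕ} (Y : Fin n → Fin d → ℝ) : IsFiniteMeasure (empMeasure Y) := by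
  unfold empMeasure; infer_instance

/-- The law of the bootstrapped network `Â*`: having observed `A ~ RDPG(F,n)` (in its
adjacency marginal), draw `Â* ~ RDPG(F̂_n, n)` where `F̂_n` is the empirical distribution
of the rows of the adjacency spectral embedding of `A`. -/
def bootLaw (d n : ℕ) (F : Measure (Fin d → ℝ)) [SigmaFinite F] :
    Measure (Fin n → Fin n → ℝ) :=
  (adjLaw d n F).bind fun a => adjLaw d n (empMeasure (ase d a))

/-- `ρ̂ = binom(n,2)⁻¹ Σ_{i<j} A_{ij}`, the empirical edge density. -/
def rhoHat {n : ℕ} (A : Fin n → Fin n → ℝ) : ℝ :=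
  ((n.choose 2 : ℝ))⁻¹ * ∑ i, ∑ j, if i < j then A i j else 0

/-- The (normalized) average degree. -/
def avgDegree {n : ℕ} (A : Fin n → Fin n → ℝ) : ℝ :=
  (n : ℝ)⁻¹ * ∑ i, (∑ j, if j ≠ i then A i j else 0) / ((n : ℝ) - 1)

/-- The subgraph-counting kernel `h_R` associated with a graph `R` on `m` vertices. -/
def subgraphKernel {m : ℕ} (d : ℕ) (R : SimpleGraph (Fin m)) (x : Fin m → Fin d → ℝ) : ℝ :=
  ((Nat.card {G : SimpleGraph (Fin m) // Nonempty (G ≃g R)} : ℝ))⁻¹ *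
    ∑ τ : Equiv.Perm (Fin m), ∏ p : Fin m × Fin m,
      if p.1 < p.2 then
        (if R.Adj p.1 p.2 then dotd (x (τ p.1)) (x (τ p.2))
          else 1 - dotd (x (τ p.1)) (x (τ p.2)))
      else 1

/-- The empirical subgraph density `P̂(R)` of `R` in the graph with adjacency matrix `A`:
the proportion of `m`-subsets of vertices whose induced subgraph is isomorphic to `R`. -/
def subgraphDensity {m n : ℕ} (R : SimpleGraph (Fin m)) (A : Fin n → Fin n → ℝ) : ℝ :=
  ((n.choose m : ℝ))⁻¹ * ∑ c : Fin m → Fin n,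
    if StrictMono c ∧ (∃ σ : Equiv.Perm (Fin m), ∀ k l : Fin m, k ≠ l →
        (A (c (σ k)) (c (σ l)) = 1 ↔ R.Adj k l)) then (1:ℝ) else 0

/-- The entrywise ℓ¹ norm of a matrix. -/
def matL1 {n : ℕ} (M : Fin n → Fin n → ℝ) : ℝ := ∑ i, ∑ j, |M i j|

/-- The graph matching distance between two `n`-vertex graphs. -/
def dGM {n : ℕ} (A B : Fin n → Fin n → ℝ) : ℝ :=
  ⨅ σ : Equiv.Perm (Fin n),
    ((n.choose 2 : ℝ))⁻¹ * (∑ i, ∑ j, |A i j - B (σ i) (σ j)|) / 2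

/-- The set of couplings of two measures. -/
def Couplings {α β : Type*} [MeasurableSpace α] [MeasurableSpace β]
    (μ : Measure α) (ν : Measure β) : Set (Measure (α × β)) :=
  {γ | IsProbabilityMeasure γ ∧ γ.map Prod.fst = μ ∧ γ.map Prod.snd = ν}

/-- `W_{GM,p}^p`: the `p`-th power of the graph-matching Wasserstein distance between two
laws of random adjacency matrices. -/
def WGMpow {n : ℕ} (p : ℝ) (μ ν : Measure (Fin n → Fin n → ℝ)) : ℝ :=
  sInf ((fun γ => ∫ q, dGM q.1 q.2 ^ p ∂γ) '' Couplings μ ν)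

/-- The Wasserstein `p`-distance between two distributions on `ℝ^d` (with Euclidean cost). -/
def wassersteinP {d : ℕ} (p : ℝ) (μ ν : Measure (Fin d → ℝ)) : ℝ :=
  sInf ((fun γ => (∫ q, euclNorm (q.1 - q.2) ^ p ∂γ) ^ (1/p)) '' Couplings μ ν)

/-- `d̊_p(F₁,F₂) = min_{Q ∈ O(d)} d_p(F₁, F₂ ∘ Q)`. -/
def ringWasserstein {d : ℕ} (p : ℝ) (μ ν : Measure (Fin d → ℝ)) : ℝ :=
  sInf {r | ∃ Q : Matrix (Fin d) (Fin d) ℝ, Qᵀ * Q = 1 ∧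
    r = wassersteinP p μ (ν.map fun x => Q.mulVec x)}

/-- The Frobenius norm of a matrix. -/
def frobNorm {n d : ℕ} (M : Matrix (Fin n) (Fin d) ℝ) : ℝ :=
  Real.sqrt (∑ i, ∑ j, (M i j) ^ 2)

/-- The `2→∞` norm of a matrix: the maximum Euclidean norm of a row. -/
def twoInftyNorm {n d : ℕ} (M : Matrix (Fin n) (Fin d) ℝ) : ℝ := ⨆ i, euclNorm (M i)

/-- `U`, `lam` form a rank-`d` spectral decomposition of the symmetric matrix `Pm`:
the columns of `U` are orthonormal eigenvectors with eigenvalues `lam`, and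
`Pm = U · diag(lam) · Uᵀ`. -/
def IsSpecDecomp {n d : ℕ} (Pm : Fin n → Fin n → ℝ) (U : Fin n → Fin d → ℝ)
    (lam : Fin d → ℝ) : Prop :=
  (∀ j j', (∑ i, U i j * U i j') = if j = j' then (1:ℝ) else 0) ∧
  (∀ j, (Matrix.of Pm).mulVec (fun i => U i j) = fun i => lam j * U i j) ∧
  (∀ i i', Pm i i' = ∑ j, U i j * lam j * U i' j)

/-- `U`, `lam` are orthonormal eigenvectors of `A` for its `d` largest-in-magnitude
eigenvalues. -/
def IsTopSpec {n d : ℕ} (A : Fin n → Fin n → ℝ) (U : Fin n → Fin d → ℝ)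
    (lam : Fin d → ℝ) : Prop :=
  (∀ j j', (∑ i, U i j * U i j') = if j = j' then (1:ℝ) else 0) ∧
  (∀ j, (Matrix.of A).mulVec (fun i => U i j) = fun i => lam j * U i j) ∧
  (∀ (mu : ℝ) (v : Fin n → ℝ), v ≠ 0 → (Matrix.of A).mulVec v = mu • v →
    (∀ j, (∑ i, v i * U i j) = 0) → ∀ j, |mu| ≤ |lam j|)

/-- The `2→∞` bound with constant `C`: `max_i ‖Qᵀ Xh_i − X_i‖ ≤ C log n / √n`. -/
def TwoToInftyBound {n d : ℕ} (C : ℝ) (Xh X : Fin n → Fin d → ℝ)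
    (Q : Matrix (Fin d) (Fin d) ℝ) : Prop :=
  ∀ i, euclNorm (Qᵀ.mulVec (Xh i) - X i) ≤ C * Real.log n / Real.sqrt n

/-- The second moment matrix `Δ = E X₁ X₁ᵀ` of a distribution `F` on `ℝ^d`. -/
def secondMoment {d : ℕ} (F : Measure (Fin d → ℝ)) : Matrix (Fin d) (Fin d) ℝ :=
  Matrix.of fun i j => ∫ x, x i * x j ∂F


lemma spec_exists {n : ℕ} (M : Matrix (Fin n) (Fin n) ℝ) (hM : Mᵀ = M) :
    ∃ (U : Matrix (Fin n) (Fin n) ℝ) (x : Fin n → ℝ), Uᵀ * U = 1 ∧ U * Uᵀ = 1 ∧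
      M = U * diagonal x * Uᵀ := by
  have hH : M.IsHermitian := by
    rw [Matrix.IsHermitian, Matrix.conjTranspose_eq_transpose_of_trivial]; exact hM
  refine ⟨hH.eigenvectorUnitary, hH.eigenvalues, ?_, ?_, ?_⟩
  · have := (Matrix.mem_unitaryGroup_iff').1 hH.eigenvectorUnitary.2
    rwa [Matrix.star_eq_conjTranspose, Matrix.conjTranspose_eq_transpose_of_trivial] at this
  · have := (Matrix.mem_unitaryGroup_iff).1 hH.eigenvectorUnitary.2
    rwa [Matrix.star_eq_conjTranspose, Matrix.conjTranspose_eq_transpose_of_trivial] at this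
  · have := hH.spectral_theorem
    rw [Unitary.conjStarAlgAut_apply] at this
    rw [Matrix.star_eq_conjTranspose, Matrix.conjTranspose_eq_transpose_of_trivial] at this
    exact this

lemma spec_pow {n : ℕ} {M U : Matrix (Fin n) (Fin n) ℝ} {x : Fin n → ℝ} (h1 : Uᵀ * U = 1)
    (h2 : U * Uᵀ = 1) (hM : M = U * diagonal x * Uᵀ) (a : ℕ) :
    M ^ a = U * diagonal (fun i => x i ^ a) * Uᵀ := by
  induction a with
  | zero => simp [h2]
  | succ a ih =>
    rw [pow_succ, ih, hM]
    calc U * diagonal (fun i => x i ^ a) * Uᵀ * (U * diagonal x * Uᵀ)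
        = U * diagonal (fun i => x i ^ a) * (Uᵀ * U) * diagonal x * Uᵀ := by
          simp only [Matrix.mul_assoc]
      _ = _ := by
          rw [h1, Matrix.mul_one, Matrix.mul_assoc U, diagonal_mul_diagonal]
          simp only [pow_succ]

lemma spec_pow_diag {n : ℕ} {M U : Matrix (Fin n) (Fin n) ℝ} {x : Fin n → ℝ} (h1 : Uᵀ * U = 1)
    (h2 : U * Uᵀ = 1) (hM : M = U * diagonal x * Uᵀ) (a : ℕ) (i : Fin n) :
    (M ^ a) i i = ∑ k, x k ^ a * U i k ^ 2 := by
  rw [spec_pow h1 h2 hM, Matrix.mul_apply]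
  refine Finset.sum_congr rfl fun k _ => ?_
  rw [Matrix.mul_diagonal, Matrix.transpose_apply]; ring

lemma orth_col {n d : ℕ} {U : Matrix (Fin n) (Fin d) ℝ} (h1 : Uᵀ * U = 1) (k : Fin d) :
    ∑ i, U i k ^ 2 = 1 := by
  have := congrFun (congrFun h1 k) k
  rw [Matrix.mul_apply, Matrix.one_apply_eq] at this
  rw [← this]; exact Finset.sum_congr rfl fun i _ => by rw [Matrix.transpose_apply]; ring

lemma orth_row {n d : ℕ} {U : Matrix (Fin n) (Fin d) ℝ} (h2 : U * Uᵀ = 1) (i : Fin n) :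
    ∑ k, U i k ^ 2 = 1 := by
  have := orth_col (U := Uᵀ) (by simpa using h2) i
  simpa using this

lemma spec_trace_pow {n : ℕ} {M U : Matrix (Fin n) (Fin n) ℝ} {x : Fin n → ℝ} (h1 : Uᵀ * U = 1)
    (h2 : U * Uᵀ = 1) (hM : M = U * diagonal x * Uᵀ) (a : ℕ) :
    (M ^ a).trace = ∑ k, x k ^ a := by
  rw [spec_pow h1 h2 hM, Matrix.trace_mul_comm, ← Matrix.mul_assoc, h1, Matrix.one_mul,
    Matrix.trace_diagonal]

lemma spec_trace_two {n : ℕ} {X U Y V : Matrix (Fin n) (Fin n) ℝ} {x y : Fin n → ℝ}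
    (h1 : Uᵀ * U = 1) (h2 : U * Uᵀ = 1) (hX : X = U * diagonal x * Uᵀ)
    (k1 : Vᵀ * V = 1) (k2 : V * Vᵀ = 1) (hY : Y = V * diagonal y * Vᵀ) (a b : ℕ) :
    (X ^ a * Y ^ b).trace = ∑ i, ∑ j, (Uᵀ * V) i j ^ 2 * (x i ^ a * y j ^ b) := by
  rw [spec_pow h1 h2 hX, spec_pow k1 k2 hY]
  have : (U * diagonal (fun i => x i ^ a) * Uᵀ * (V * diagonal (fun i => y i ^ b) * Vᵀ)).trace
      = (diagonal (fun i => x i ^ a) * (Uᵀ * V) * (diagonal (fun i => y i ^ b) * (Uᵀ * V)ᵀ)).trace := by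
    rw [Matrix.mul_assoc U, Matrix.mul_assoc U, Matrix.trace_mul_comm U]
    simp only [Matrix.mul_assoc, Matrix.transpose_mul, Matrix.transpose_transpose]
  rw [this, Matrix.trace]
  refine Finset.sum_congr rfl fun i _ => ?_
  rw [Matrix.diag_apply, Matrix.mul_apply]
  refine Finset.sum_congr rfl fun j _ => ?_
  rw [Matrix.diagonal_mul, Matrix.diagonal_mul, Matrix.transpose_apply]; ring

lemma scalar_ineq (x y : ℝ) (q : ℕ) :
    (x - y) * (x ^ (2 * q + 1) - y ^ (2 * q + 1)) ≤
      (2 * q + 1 : ℝ) / 2 * ((x - y) ^ 2 * (x ^ (2 * q) + y ^ (2 * q))) := by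
  -- x^k - y^k = (x-y) Σ x^i y^(k-1-i)
  have h := (Commute.all x y).geom_sum₂_mul (n := 2 * q + 1)
  have key : ∑ i ∈ Finset.range (2 * q + 1), x ^ i * y ^ (2 * q + 1 - 1 - i)
      ≤ (2 * q + 1 : ℝ) / 2 * (x ^ (2 * q) + y ^ (2 * q)) := by
    have hrefl := Finset.sum_range_reflect (fun i => x ^ i * y ^ (2 * q + 1 - 1 - i)) (2 * q + 1)
    have h2 : ∑ i ∈ Finset.range (2 * q + 1), (x ^ i * y ^ (2 * q + 1 - 1 - i) +
        x ^ (2 * q + 1 - 1 - i) * y ^ (2 * q + 1 - 1 - (2 * q + 1 - 1 - i))) ≤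
        ∑ i ∈ Finset.range (2 * q + 1), (x ^ (2 * q) + y ^ (2 * q)) := by
      refine Finset.sum_le_sum fun i hi => ?_
      have hi' : i ≤ 2 * q := by have := Finset.mem_range.1 hi; omega
      have e1 : 2 * q + 1 - 1 - i = 2 * q - i := by omega
      have e2 : 2 * q + 1 - 1 - (2 * q + 1 - 1 - i) = i := by omega
      rw [e2, e1]
      have hab : x ^ (2 * q) = |x| ^ (i + (2 * q - i)) := by
        rw [show i + (2 * q - i) = 2 * q by omega, pow_mul, pow_mul, sq_abs]
      have hab' : y ^ (2 * q) = |y| ^ (i + (2 * q - i)) := by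
        rw [show i + (2 * q - i) = 2 * q by omega, pow_mul, pow_mul, sq_abs]
      rw [hab, hab', pow_add, pow_add]
      have l1 : x ^ i * y ^ (2 * q - i) ≤ |x| ^ i * |y| ^ (2 * q - i) := by
        calc _ ≤ |x ^ i * y ^ (2 * q - i)| := le_abs_self _
          _ = _ := by rw [abs_mul, abs_pow, abs_pow]
      have l2 : x ^ (2 * q - i) * y ^ i ≤ |x| ^ (2 * q - i) * |y| ^ i := by
        calc _ ≤ |x ^ (2 * q - i) * y ^ i| := le_abs_self _
          _ = _ := by rw [abs_mul, abs_pow, abs_pow]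
      have l3 : 0 ≤ (|x| ^ i - |y| ^ i) * (|x| ^ (2 * q - i) - |y| ^ (2 * q - i)) := by
        rcases le_total |x| |y| with h | h
        · exact mul_nonneg_of_nonpos_of_nonpos
            (sub_nonpos.2 (pow_le_pow_left₀ (abs_nonneg _) h _))
            (sub_nonpos.2 (pow_le_pow_left₀ (abs_nonneg _) h _))
        · exact mul_nonneg
            (sub_nonneg.2 (pow_le_pow_left₀ (abs_nonneg _) h _))
            (sub_nonneg.2 (pow_le_pow_left₀ (abs_nonneg _) h _))
      nlinarith
    rw [Finset.sum_add_distrib, hrefl] at h2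
    rw [Finset.sum_const, Finset.card_range, nsmul_eq_mul] at h2
    push_cast at h2 ⊢
    linarith
  rw [← h]
  nlinarith [mul_le_mul_of_nonneg_left key (sq_nonneg (x - y))]

lemma trace_ineq {n : ℕ} (X Y : Matrix (Fin n) (Fin n) ℝ) (hX : Xᵀ = X) (hY : Yᵀ = Y) (q : ℕ) :
    ((X - Y) * (X ^ (2 * q + 1) - Y ^ (2 * q + 1))).trace ≤
      (2 * q + 1 : ℝ) / 2 * ((X - Y) * (X - Y) * (X ^ (2 * q) + Y ^ (2 * q))).trace := by
  obtain ⟨U, x, h1, h2, h3⟩ := spec_exists X hX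
  obtain ⟨V, y, k1, k2, k3⟩ := spec_exists Y hY
  have T := spec_trace_two h1 h2 h3 k1 k2 k3
  have L : ((X - Y) * (X ^ (2 * q + 1) - Y ^ (2 * q + 1))).trace =
      (X ^ (2 * q + 2) * Y ^ 0).trace - (X ^ 1 * Y ^ (2 * q + 1)).trace
        - (X ^ (2 * q + 1) * Y ^ 1).trace + (X ^ 0 * Y ^ (2 * q + 2)).trace := by
    rw [Matrix.sub_mul, Matrix.mul_sub, Matrix.mul_sub, ← pow_succ', ← pow_succ',
      Matrix.trace_sub, Matrix.trace_sub, Matrix.trace_sub, Matrix.trace_mul_comm Y]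
    simp only [pow_zero, pow_one, Matrix.mul_one, Matrix.one_mul]; ring
  have R : ((X - Y) * (X - Y) * (X ^ (2 * q) + Y ^ (2 * q))).trace =
      (X ^ (2 * q + 2) * Y ^ 0).trace - 2 * (X ^ (2 * q + 1) * Y ^ 1).trace
        + (X ^ (2 * q) * Y ^ 2).trace + (X ^ 2 * Y ^ (2 * q)).trace
        - 2 * (X ^ 1 * Y ^ (2 * q + 1)).trace + (X ^ 0 * Y ^ (2 * q + 2)).trace := by
    have e1 : (X * X * X ^ (2 * q)).trace = (X ^ (2 * q + 2)).trace := by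
      rw [pow_add, ← pow_two, ← pow_add, ← pow_add, add_comm]
    have e2 : (X * Y * X ^ (2 * q)).trace = (X ^ (2 * q + 1) * Y).trace := by
      rw [Matrix.trace_mul_comm, ← Matrix.mul_assoc, ← pow_succ]
    have e3 : (Y * X * X ^ (2 * q)).trace = (X ^ (2 * q + 1) * Y).trace := by
      rw [Matrix.mul_assoc, ← pow_succ', Matrix.trace_mul_comm]
    have e4 : (Y * Y * X ^ (2 * q)).trace = (X ^ (2 * q) * Y ^ 2).trace := by
      rw [Matrix.trace_mul_comm, pow_two]
    have e5 : (X * Y * Y ^ (2 * q)).trace = (X * Y ^ (2 * q + 1)).trace := by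
      rw [Matrix.mul_assoc, ← pow_succ']
    have e6 : (Y * X * Y ^ (2 * q)).trace = (X * Y ^ (2 * q + 1)).trace := by
      rw [Matrix.trace_mul_comm, ← Matrix.mul_assoc, ← pow_succ, Matrix.trace_mul_comm]
    have e7 : (Y * Y * Y ^ (2 * q)).trace = (Y ^ (2 * q + 2)).trace := by
      rw [pow_add, ← pow_two, ← pow_add, ← pow_add, add_comm]
    rw [show (X - Y) * (X - Y) * (X ^ (2 * q) + Y ^ (2 * q)) =
      X * X * X ^ (2 * q) - X * Y * X ^ (2 * q) - Y * X * X ^ (2 * q) + Y * Y * X ^ (2 * q)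
      + X * X * Y ^ (2 * q) - X * Y * Y ^ (2 * q) - Y * X * Y ^ (2 * q) + Y * Y * Y ^ (2 * q) by
        noncomm_ring]
    simp only [Matrix.trace_sub, Matrix.trace_add, e1, e2, e3, e4, e5, e6, e7]
    simp only [pow_zero, pow_one, Matrix.mul_one, Matrix.one_mul, pow_two]; ring
  rw [L, R]
  simp only [T, Finset.mul_sum, ← Finset.sum_sub_distrib, ← Finset.sum_add_distrib]
  refine Finset.sum_le_sum fun i _ => Finset.sum_le_sum fun j _ => ?_
  have := mul_le_mul_of_nonneg_left (scalar_ineq (x i) (y j) q) (sq_nonneg ((Uᵀ * V) i j))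
  convert this using 1 <;> ring

/-- If all eigenvalues are bounded then so is the operator. -/
lemma op_of_eigs {n : ℕ} (M : Matrix (Fin n) (Fin n) ℝ) (hM : Mᵀ = M) (t : ℝ)
    (h : ∀ (mu : ℝ) (v : Fin n → ℝ), v ≠ 0 → M.mulVec v = mu • v → |mu| ≤ t) (v : Fin n → ℝ) :
    M.mulVec v ⬝ᵥ M.mulVec v ≤ t ^ 2 * (v ⬝ᵥ v) := by
  obtain ⟨U, x, h1, h2, h3⟩ := spec_exists M hM
  have hx : ∀ k, |x k| ≤ t := by
    intro k
    refine h (x k) (fun i => U i k) ?_ ?_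
    · intro h0
      have := orth_col h1 k
      have h0' : ∀ i, U i k = 0 := fun i => congrFun h0 i
      simp [h0'] at this
    · have : M * U = U * diagonal x := by rw [h3, Matrix.mul_assoc, h1, Matrix.mul_one]
      ext i
      have := congrFun (congrFun this i) k
      rw [Matrix.mul_diagonal, Matrix.mul_apply] at this
      rw [Matrix.mulVec, dotProduct, this]; simp [mul_comm]
  have e : M.mulVec v ⬝ᵥ M.mulVec v = ∑ k, x k ^ 2 * (Uᵀ.mulVec v k) ^ 2 := by
    rw [Matrix.dotProduct_mulVec, ← Matrix.mulVec_transpose, hM, Matrix.mulVec_mulVec, ← pow_two,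
      spec_pow h1 h2 h3 2, ← Matrix.mulVec_mulVec, ← Matrix.mulVec_mulVec, dotProduct_comm,
      Matrix.dotProduct_mulVec, ← Matrix.mulVec_transpose, dotProduct]
    refine Finset.sum_congr rfl fun k _ => ?_
    rw [Matrix.mulVec_diagonal]; ring
  have e2 : v ⬝ᵥ v = ∑ k, (Uᵀ.mulVec v k) ^ 2 := by
    have : v ⬝ᵥ v = Uᵀ.mulVec v ⬝ᵥ Uᵀ.mulVec v := by
      rw [Matrix.dotProduct_mulVec, ← Matrix.mulVec_transpose, Matrix.transpose_transpose,
        Matrix.mulVec_mulVec, h2, Matrix.one_mulVec]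
    rw [this, dotProduct]; exact Finset.sum_congr rfl fun k _ => by ring
  rw [e, e2, Finset.mul_sum]
  refine Finset.sum_le_sum fun k _ => mul_le_mul_of_nonneg_right ?_ (sq_nonneg _)
  exact sq_le_sq' (by linarith [abs_le.1 (hx k)]) (abs_le.1 (hx k)).2

section FrobeniusPart
open scoped Matrix.Norms.Frobenius

lemma fro_sq {n d : ℕ} (B : Matrix (Fin n) (Fin d) ℝ) : ‖B‖ ^ 2 = ∑ i, ∑ j, B i j ^ 2 := by
  rw [Matrix.frobenius_norm_def, ← Real.sqrt_eq_rpow, Real.sq_sqrt]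
  · simp
  · positivity

lemma fro_sq_trace {n d : ℕ} (B : Matrix (Fin n) (Fin d) ℝ) : ‖B‖ ^ 2 = (Bᵀ * B).trace := by
  rw [fro_sq, Finset.sum_comm, Matrix.trace]
  refine Finset.sum_congr rfl fun j _ => ?_
  rw [Matrix.diag_apply, Matrix.mul_apply]
  exact Finset.sum_congr rfl fun i _ => by rw [Matrix.transpose_apply]; ring

lemma fro_orth {n d : ℕ} {U : Matrix (Fin n) (Fin d) ℝ} (h : Uᵀ * U = 1) : ‖U‖ ^ 2 = d := by
  rw [fro_sq_trace, h, Matrix.trace_one, Fintype.card_fin]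

lemma trace_le_fro {n d : ℕ} (B C : Matrix (Fin n) (Fin d) ℝ) : (Bᵀ * C).trace ≤ ‖B‖ * ‖C‖ := by
  have h : (Bᵀ * C).trace = ∑ p : Fin n × Fin d, B p.1 p.2 * C p.1 p.2 := by
    rw [Matrix.trace, Fintype.sum_prod_type, Finset.sum_comm]
    refine Finset.sum_congr rfl fun j _ => ?_
    rw [Matrix.diag_apply, Matrix.mul_apply]; rfl
  have hs : ∀ D : Matrix (Fin n) (Fin d) ℝ, ∑ p : Fin n × Fin d, D p.1 p.2 ^ 2 = ‖D‖ ^ 2 := by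
    intro D; rw [fro_sq, Fintype.sum_prod_type]
  rw [h]
  have := Finset.sum_mul_sq_le_sq_mul_sq Finset.univ (fun p : Fin n × Fin d => B p.1 p.2)
    (fun p => C p.1 p.2)
  rw [hs, hs, ← mul_pow] at this
  exact abs_le_of_sq_le_sq' this (by positivity) |>.2

lemma eucl_sq {d : ℕ} (x : Fin d → ℝ) : euclNorm x ^ 2 = x ⬝ᵥ x := by
  rw [euclNorm, Real.sq_sqrt (by positivity), dotProduct]
  exact Finset.sum_congr rfl fun i _ => by ring

lemma eucl_nonneg {d : ℕ} (x : Fin d → ℝ) : 0 ≤ euclNorm x := Real.sqrt_nonneg _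

lemma eucl_row_le {n d : ℕ} (B : Matrix (Fin n) (Fin d) ℝ) (i : Fin n) : euclNorm (B i) ≤ ‖B‖ := by
  refine abs_le_of_sq_le_sq' ?_ (norm_nonneg _) |>.2
  rw [fro_sq, euclNorm, Real.sq_sqrt (by positivity)]
  exact Finset.single_le_sum (f := fun i => ∑ j, B i j ^ 2) (fun i _ => by positivity)
    (Finset.mem_univ i)

lemma eucl_eq_norm {d : ℕ} (x : Fin d → ℝ) : euclNorm x = ‖WithLp.toLp 2 x‖ := by
  rw [euclNorm, EuclideanSpace.norm_eq]; simp

lemma eucl_add_le {d : ℕ} (x y : Fin d → ℝ) : euclNorm (x + y) ≤ euclNorm x + euclNorm y := by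
  simp only [eucl_eq_norm, WithLp.toLp_add]; exact norm_add_le _ _

lemma eucl_neg {d : ℕ} (x : Fin d → ℝ) : euclNorm (-x) = euclNorm x := by
  simp [euclNorm]

lemma dot_le_eucl {d : ℕ} (x y : Fin d → ℝ) : x ⬝ᵥ y ≤ euclNorm x * euclNorm y := by
  have := Finset.sum_mul_sq_le_sq_mul_sq Finset.univ x y
  refine abs_le_of_sq_le_sq' (a := x ⬝ᵥ y) ?_ (mul_nonneg (eucl_nonneg _) (eucl_nonneg _)) |>.2
  rw [mul_pow, euclNorm, euclNorm, Real.sq_sqrt (by positivity), Real.sq_sqrt (by positivity)]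
  exact this

lemma eucl_vecMul_le {n d : ℕ} (x : Fin n → ℝ) (B : Matrix (Fin n) (Fin d) ℝ) :
    euclNorm (x ᵥ* B) ≤ euclNorm x * ‖B‖ := by
  refine abs_le_of_sq_le_sq' ?_ (mul_nonneg (eucl_nonneg _) (norm_nonneg _)) |>.2
  rw [mul_pow, fro_sq, euclNorm, euclNorm, Real.sq_sqrt (by positivity), Real.sq_sqrt (by positivity),
    Finset.sum_comm, Finset.mul_sum]
  exact Finset.sum_le_sum fun j _ => Finset.sum_mul_sq_le_sq_mul_sq Finset.univ x (fun i => B i j)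

/-- operator bound -/
def OpLe {n : ℕ} (E : Matrix (Fin n) (Fin n) ℝ) (t : ℝ) : Prop :=
  ∀ v : Fin n → ℝ, E.mulVec v ⬝ᵥ E.mulVec v ≤ t ^ 2 * (v ⬝ᵥ v)

lemma OpLe.fro {n d : ℕ} {E : Matrix (Fin n) (Fin n) ℝ} {t : ℝ} (h : OpLe E t) (ht : 0 ≤ t)
    (B : Matrix (Fin n) (Fin d) ℝ) : ‖E * B‖ ≤ t * ‖B‖ := by
  refine abs_le_of_sq_le_sq' ?_ (by positivity) |>.2
  rw [mul_pow, fro_sq, fro_sq, Finset.sum_comm, Finset.sum_comm (γ := Fin n), Finset.mul_sum]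
  refine Finset.sum_le_sum fun j _ => ?_
  have := h (fun i => B i j)
  simp only [dotProduct, ← pow_two] at this
  exact this

lemma OpLe.quad {n : ℕ} {E : Matrix (Fin n) (Fin n) ℝ} {t : ℝ} (h : OpLe E t) (ht : 0 ≤ t)
    (v : Fin n → ℝ) : |v ⬝ᵥ E.mulVec v| ≤ t * (v ⬝ᵥ v) := by
  have h1 : euclNorm (E.mulVec v) ≤ t * euclNorm v := by
    refine abs_le_of_sq_le_sq' ?_ (mul_nonneg ht (eucl_nonneg _)) |>.2
    rw [mul_pow, eucl_sq, eucl_sq]; exact h v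
  have h2 := dot_le_eucl v (E.mulVec v)
  have h3 := dot_le_eucl (-v) (E.mulVec v)
  rw [eucl_neg, neg_dotProduct] at h3
  have h4 : euclNorm v * euclNorm (E.mulVec v) ≤ t * (v ⬝ᵥ v) := by
    rw [← eucl_sq]; nlinarith [mul_le_mul_of_nonneg_left h1 (eucl_nonneg v)]
  rw [abs_le]; constructor <;> linarith

/-- `θ G` lower bound for row vectors -/
lemma row_lower {d : ℕ} (G : Matrix (Fin d) (Fin d) ℝ) (g : ℝ)
    (h : ∀ w : Fin d → ℝ, g * (w ⬝ᵥ w) ≤ w ⬝ᵥ G.mulVec w) (x : Fin d → ℝ) :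
    g * euclNorm x ≤ euclNorm (x ᵥ* G) := by
  rcases (eucl_nonneg x).eq_or_lt with h0 | h0
  · rw [← h0, mul_zero]; exact eucl_nonneg _
  have h1 := h x
  rw [Matrix.dotProduct_mulVec, ← eucl_sq] at h1
  have h2 := dot_le_eucl (x ᵥ* G) x
  have : (g * euclNorm x) * euclNorm x ≤ euclNorm (x ᵥ* G) * euclNorm x := by nlinarith
  exact le_of_mul_le_mul_right this h0

lemma fro_rows {n d : ℕ} (B : Matrix (Fin n) (Fin d) ℝ) : ‖B‖ ^ 2 = ∑ i, euclNorm (B i) ^ 2 := by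
  rw [fro_sq]; refine Finset.sum_congr rfl fun i _ => ?_
  rw [euclNorm, Real.sq_sqrt (by positivity)]

lemma fro_lower {n d : ℕ} (G : Matrix (Fin d) (Fin d) ℝ) (g : ℝ) (hg : 0 ≤ g)
    (h : ∀ w : Fin d → ℝ, g * (w ⬝ᵥ w) ≤ w ⬝ᵥ G.mulVec w) (B : Matrix (Fin n) (Fin d) ℝ) :
    g * ‖B‖ ≤ ‖B * G‖ := by
  refine abs_le_of_sq_le_sq' ?_ (by positivity) |>.2
  rw [mul_pow, fro_rows, fro_rows, Finset.mul_sum]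
  refine Finset.sum_le_sum fun i _ => ?_
  rw [← mul_pow]
  exact pow_le_pow_left₀ (mul_nonneg hg (eucl_nonneg _)) (row_lower G g h (B i)) 2

end FrobeniusPart

section DetPart

/-- data of a top-`d` eigen-decomposition, in matrix form -/
structure TopEig {n d : ℕ} (A : Matrix (Fin n) (Fin n) ℝ) (U : Matrix (Fin n) (Fin d) ℝ)
    (lam : Fin d → ℝ) : Prop where
  orth : Uᵀ * U = 1
  eig : A * U = U * diagonal lam
  top : ∀ (mu : ℝ) (v : Fin n → ℝ), v ≠ 0 → A.mulVec v = mu • v → Uᵀ.mulVec v = 0 →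
    ∀ j, |mu| ≤ |lam j|

lemma TopEig.eigT {n d : ℕ} {A : Matrix (Fin n) (Fin n) ℝ} {U : Matrix (Fin n) (Fin d) ℝ}
    {lam : Fin d → ℝ} (h : TopEig A U lam) (hA : Aᵀ = A) : Uᵀ * A = diagonal lam * Uᵀ := by
  have := congrArg Matrix.transpose h.eig
  simpa [Matrix.transpose_mul, hA] using this

lemma TopEig.deflate {n d : ℕ} {A : Matrix (Fin n) (Fin n) ℝ} {U : Matrix (Fin n) (Fin d) ℝ}
    {lam : Fin d → ℝ} (h : TopEig A U lam) (hA : Aᵀ = A) (l : Fin d → ℝ) (mu : ℝ) (v : Fin n → ℝ)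
    (hv : (A - U * diagonal l * Uᵀ).mulVec v = mu • v) :
    (Uᵀ.mulVec v = 0 ∧ A.mulVec v = mu • v) ∨ ∃ k, mu = lam k - l k := by
  have e : Uᵀ * (A - U * diagonal l * Uᵀ) = diagonal (fun k => lam k - l k) * Uᵀ := by
    rw [Matrix.mul_sub, h.eigT hA, ← Matrix.mul_assoc, ← Matrix.mul_assoc, h.orth, Matrix.one_mul,
      ← Matrix.sub_mul, diagonal_sub]
  have e2 : ∀ k, (lam k - l k) * (Uᵀ.mulVec v k) = mu * (Uᵀ.mulVec v k) := by
    intro k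
    have h1 : Uᵀ.mulVec ((A - U * diagonal l * Uᵀ).mulVec v) = Uᵀ.mulVec (mu • v) := by rw [hv]
    rw [Matrix.mulVec_mulVec, e, ← Matrix.mulVec_mulVec, Matrix.mulVec_smul] at h1
    have := congrFun h1 k
    rw [Matrix.mulVec_diagonal] at this
    simpa using this
  by_cases hz : Uᵀ.mulVec v = 0
  · left; refine ⟨hz, ?_⟩
    rw [← hv, Matrix.sub_mulVec, ← Matrix.mulVec_mulVec, hz, Matrix.mulVec_zero, sub_zero]
  · right
    obtain ⟨k, hk⟩ := Function.ne_iff.1 hz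
    exact ⟨k, (mul_right_cancel₀ hk (e2 k)).symm⟩

lemma deflate_symm {n d : ℕ} {A : Matrix (Fin n) (Fin n) ℝ} (U : Matrix (Fin n) (Fin d) ℝ)
    (hA : Aᵀ = A) (l : Fin d → ℝ) : (A - U * diagonal l * Uᵀ)ᵀ = A - U * diagonal l * Uᵀ := by
  simp [Matrix.transpose_mul, hA, Matrix.mul_assoc]

lemma quad_gram {n d : ℕ} (Y : Matrix (Fin n) (Fin d) ℝ) (v : Fin n → ℝ) :
    v ⬝ᵥ (Y * Yᵀ).mulVec v = Yᵀ.mulVec v ⬝ᵥ Yᵀ.mulVec v := by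
  rw [← Matrix.mulVec_mulVec, Matrix.dotProduct_mulVec, ← Matrix.mulVec_transpose]

lemma dot_self_nonneg {n : ℕ} (v : Fin n → ℝ) : 0 ≤ v ⬝ᵥ v := by
  rw [← eucl_sq]; positivity

lemma dot_self_pos {n : ℕ} {v : Fin n → ℝ} (h : v ≠ 0) : 0 < v ⬝ᵥ v :=
  lt_of_le_of_ne (dot_self_nonneg v) (fun h0 => h (dotProduct_self_eq_zero.1 h0.symm))

lemma TopEig.lam_lower {n d : ℕ} {A : Matrix (Fin n) (Fin n) ℝ} {U : Matrix (Fin n) (Fin d) ℝ}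
    {lam : Fin d → ℝ} (h : TopEig A U lam) (hA : Aᵀ = A) (Y : Matrix (Fin n) (Fin d) ℝ)
    {τ g : ℝ} (hτ : 0 ≤ τ) (hE : OpLe (A - Y * Yᵀ) τ)
    (hg : ∀ w : Fin d → ℝ, g * (w ⬝ᵥ w) ≤ Y.mulVec w ⬝ᵥ Y.mulVec w) (hg0 : 0 < g)
    (hgt : 4 * τ ≤ g) (j : Fin d) : g - τ ≤ lam j := by
  have hquad : ∀ v, v ⬝ᵥ A.mulVec v = Yᵀ.mulVec v ⬝ᵥ Yᵀ.mulVec v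
      + v ⬝ᵥ (A - Y * Yᵀ).mulVec v := by
    intro v; rw [← quad_gram, ← dotProduct_add, ← Matrix.add_mulVec]; simp
  -- lower bound in absolute value
  have habs : g - τ ≤ |lam j| := by
    set l := Function.update lam j 0 with hl
    set B := A - U * diagonal l * Uᵀ with hB
    have hop : OpLe B |lam j| := by
      refine op_of_eigs B (deflate_symm U hA l) _ ?_
      intro mu v hv0 hv
      rcases h.deflate hA l mu v hv with ⟨h1, h2⟩ | ⟨k, hk⟩
      · exact h.top mu v hv0 h2 h1 j
      · by_cases hkj : k = j
        · subst hkj; simp [hl] at hk; rw [hk]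
        · rw [hl, Function.update_of_ne hkj, sub_self] at hk; rw [hk]; simp
    -- a vector
    let N : Matrix (Fin d) (Fin d) ℝ := Matrix.updateRow (Uᵀ * Y) j 0
    have hN : N.det = 0 := Matrix.det_eq_zero_of_row_eq_zero j (by intro k; simp [N])
    obtain ⟨w, hw0, hw⟩ := Matrix.exists_mulVec_eq_zero_iff.2 hN
    have hwk : ∀ k, k ≠ j → Uᵀ.mulVec (Y.mulVec w) k = 0 := by
      intro k hk
      rw [Matrix.mulVec_mulVec]
      have hNk : N k = (Uᵀ * Y) k := Matrix.updateRow_ne hk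
      change (Uᵀ * Y) k ⬝ᵥ w = 0
      rw [← hNk]; exact congrFun hw k
    set v := Y.mulVec w with hv
    have hww := dot_self_pos hw0
    have hvv : g * (w ⬝ᵥ w) ≤ v ⬝ᵥ v := hg w
    have hvpos : 0 < v ⬝ᵥ v := lt_of_lt_of_le (mul_pos hg0 hww) hvv
    -- ‖Yᵀ v‖² ≥ g ‖v‖²
    have hYv : g * (v ⬝ᵥ v) ≤ Yᵀ.mulVec v ⬝ᵥ Yᵀ.mulVec v := by
      have h1 : v ⬝ᵥ v = Yᵀ.mulVec v ⬝ᵥ w := by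
        rw [hv, Matrix.dotProduct_mulVec, ← Matrix.mulVec_transpose]
      have h2 := dot_le_eucl (Yᵀ.mulVec v) w
      rw [← h1] at h2
      have h3 : (v ⬝ᵥ v) ^ 2 ≤ (Yᵀ.mulVec v ⬝ᵥ Yᵀ.mulVec v) * (w ⬝ᵥ w) := by
        rw [← eucl_sq (Yᵀ.mulVec v), ← eucl_sq w, ← mul_pow]
        exact pow_le_pow_left₀ hvpos.le h2 2
      have h4 : (g * (v ⬝ᵥ v)) * (w ⬝ᵥ w) ≤ (Yᵀ.mulVec v ⬝ᵥ Yᵀ.mulVec v) * (w ⬝ᵥ w) := by nlinarith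
      exact le_of_mul_le_mul_right h4 hww
    have hBv : v ⬝ᵥ B.mulVec v = v ⬝ᵥ A.mulVec v := by
      have : (U * diagonal l * Uᵀ).mulVec v = 0 := by
        rw [← Matrix.mulVec_mulVec, ← Matrix.mulVec_mulVec]
        have : (diagonal l).mulVec (Uᵀ.mulVec v) = 0 := by
          ext k
          rw [Matrix.mulVec_diagonal]
          by_cases hk : k = j
          · subst hk; simp [hl]
          · rw [hwk k hk]; simp
        rw [this, Matrix.mulVec_zero]
      rw [hB, Matrix.sub_mulVec, this, sub_zero]
    have q1 := hop.quad (abs_nonneg _) v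
    have q2 := hE.quad hτ v
    rw [hBv, hquad] at q1
    have : (g - τ) * (v ⬝ᵥ v) ≤ |lam j| * (v ⬝ᵥ v) := by
      have := (abs_le.1 q1).2
      have := (abs_le.1 q2).1
      nlinarith
    exact le_of_mul_le_mul_right this hvpos
  -- sign
  have hsign : -τ ≤ lam j := by
    let u : Fin n → ℝ := fun i => U i j
    have huu : u ⬝ᵥ u = 1 := by
      rw [← orth_col h.orth j, dotProduct]; exact Finset.sum_congr rfl fun i _ => by simp [u]; ring
    have hAu : A.mulVec u = lam j • u := by
      ext i
      have := congrFun (congrFun h.eig i) j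
      rw [Matrix.mul_diagonal, Matrix.mul_apply] at this
      rw [Matrix.mulVec, dotProduct, this]; simp [u, mul_comm]
    have := hquad u
    rw [hAu, dotProduct_smul, huu, smul_eq_mul, mul_one] at this
    have q2 := hE.quad hτ u
    rw [huu, mul_one] at q2
    have := (abs_le.1 q2).1
    have := dot_self_nonneg (Yᵀ.mulVec u)
    linarith
  rcases abs_cases (lam j) with ⟨h1, _⟩ | ⟨h1, _⟩ <;> linarith

lemma diag_quad_lower {d : ℕ} (lam : Fin d → ℝ) (c : ℝ) (h : ∀ j, c ≤ lam j) (w : Fin d → ℝ) :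
    c * (w ⬝ᵥ w) ≤ w ⬝ᵥ (diagonal lam).mulVec w := by
  simp only [dotProduct, Matrix.mulVec_diagonal, Finset.mul_sum]
  exact Finset.sum_le_sum fun k _ => by nlinarith [h k, mul_self_nonneg (w k)]

lemma orth_dot {n d : ℕ} {U : Matrix (Fin n) (Fin d) ℝ} (h : Uᵀ * U = 1) (w : Fin d → ℝ) :
    U.mulVec w ⬝ᵥ U.mulVec w = w ⬝ᵥ w := by
  rw [Matrix.dotProduct_mulVec, ← Matrix.mulVec_transpose, Matrix.mulVec_mulVec, h,
    Matrix.one_mulVec]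

/-- `K Kᵀ` is bounded below, where `K = Uᵀ Y`. -/
lemma TopEig.KKt_eq {n d : ℕ} {A : Matrix (Fin n) (Fin n) ℝ} {U : Matrix (Fin n) (Fin d) ℝ}
    {lam : Fin d → ℝ} (h : TopEig A U lam) (Y : Matrix (Fin n) (Fin d) ℝ) :
    (Uᵀ * Y) * (Uᵀ * Y)ᵀ = diagonal lam - Uᵀ * (A - Y * Yᵀ) * U := by
  have : Uᵀ * A * U = diagonal lam := by
    rw [Matrix.mul_assoc, h.eig, ← Matrix.mul_assoc, h.orth, Matrix.one_mul]
  rw [Matrix.mul_sub, Matrix.sub_mul, this]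
  simp [Matrix.transpose_mul, Matrix.mul_assoc]

lemma TopEig.KKt_lower {n d : ℕ} {A : Matrix (Fin n) (Fin n) ℝ} {U : Matrix (Fin n) (Fin d) ℝ}
    {lam : Fin d → ℝ} (h : TopEig A U lam) (hA : Aᵀ = A) (Y : Matrix (Fin n) (Fin d) ℝ)
    {τ g : ℝ} (hτ : 0 ≤ τ) (hE : OpLe (A - Y * Yᵀ) τ)
    (hg : ∀ w : Fin d → ℝ, g * (w ⬝ᵥ w) ≤ Y.mulVec w ⬝ᵥ Y.mulVec w) (hg0 : 0 < g)
    (hgt : 4 * τ ≤ g) (w : Fin d → ℝ) :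
    (g - 2 * τ) * (w ⬝ᵥ w) ≤ w ⬝ᵥ ((Uᵀ * Y) * (Uᵀ * Y)ᵀ).mulVec w := by
  rw [h.KKt_eq, Matrix.sub_mulVec, dotProduct_sub]
  have h1 := diag_quad_lower lam (g - τ) (h.lam_lower hA Y hτ hE hg hg0 hgt) w
  have h2 : w ⬝ᵥ (Uᵀ * (A - Y * Yᵀ) * U).mulVec w = U.mulVec w ⬝ᵥ (A - Y * Yᵀ).mulVec (U.mulVec w) := by
    rw [← Matrix.mulVec_mulVec, ← Matrix.mulVec_mulVec, Matrix.dotProduct_mulVec w,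
      ← Matrix.mulVec_transpose, Matrix.transpose_transpose]
  have h3 := hE.quad hτ (U.mulVec w)
  rw [orth_dot h.orth] at h3
  have := (abs_le.1 h3).2
  rw [h2]; linarith

lemma posDef_of_lower {d : ℕ} (S : Matrix (Fin d) (Fin d) ℝ) (hS : Sᵀ = S) (c : ℝ) (hc : 0 < c)
    (h : ∀ w : Fin d → ℝ, c * (w ⬝ᵥ w) ≤ w ⬝ᵥ S.mulVec w) : S.PosDef := by
  refine Matrix.PosDef.of_dotProduct_mulVec_pos ?_ ?_
  · rw [Matrix.IsHermitian, Matrix.conjTranspose_eq_transpose_of_trivial, hS]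
  · intro w hw
    have : star w = w := by ext; simp
    rw [this]
    exact lt_of_lt_of_le (mul_pos hc (dot_self_pos hw)) (h w)

/-- all eigenvalues of the deflated matrix are at most `τ` -/
lemma TopEig.resid {n d : ℕ} {A : Matrix (Fin n) (Fin n) ℝ} {U : Matrix (Fin n) (Fin d) ℝ}
    {lam : Fin d → ℝ} (h : TopEig A U lam) (hA : Aᵀ = A) (Y : Matrix (Fin n) (Fin d) ℝ)
    {τ g : ℝ} (hτ : 0 ≤ τ) (hE : OpLe (A - Y * Yᵀ) τ)
    (hg : ∀ w : Fin d → ℝ, g * (w ⬝ᵥ w) ≤ Y.mulVec w ⬝ᵥ Y.mulVec w) (hg0 : 0 < g)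
    (hgt : 4 * τ ≤ g) : OpLe (A - U * diagonal lam * Uᵀ) τ := by
  have hquad : ∀ v, v ⬝ᵥ A.mulVec v = Yᵀ.mulVec v ⬝ᵥ Yᵀ.mulVec v
      + v ⬝ᵥ (A - Y * Yᵀ).mulVec v := by
    intro v; rw [← quad_gram, ← dotProduct_add, ← Matrix.add_mulVec]; simp
  refine op_of_eigs _ (deflate_symm U hA lam) _ ?_
  intro mu v hv0 hv
  rcases h.deflate hA lam mu v hv with ⟨h1, h2⟩ | ⟨k, hk⟩
  swap
  · rw [hk, sub_self]; simpa using hτ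
  have hvv := dot_self_pos hv0
  have hmu : v ⬝ᵥ A.mulVec v = mu * (v ⬝ᵥ v) := by rw [h2, dotProduct_smul, smul_eq_mul]
  rw [abs_le]; constructor
  · have q := (abs_le.1 (hE.quad hτ v)).1
    have := hquad v
    have := dot_self_nonneg (Yᵀ.mulVec v)
    have : (-τ) * (v ⬝ᵥ v) ≤ mu * (v ⬝ᵥ v) := by linarith
    exact le_of_mul_le_mul_right this hvv
  · set K := Uᵀ * Y with hK
    have hpd : (K * Kᵀ).PosDef := posDef_of_lower _ (by simp [Matrix.transpose_mul]) (g - 2 * τ)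
      (by linarith) (h.KKt_lower hA Y hτ hE hg hg0 hgt)
    have hdet : IsUnit Kᵀ.det := by
      have := hpd.det_pos
      rw [Matrix.det_mul] at this
      exact isUnit_iff_ne_zero.2 (fun h0 => by rw [h0] at this; simp at this)
    set β := -(Kᵀ)⁻¹.mulVec (Yᵀ.mulVec v) with hβ
    have hKβ : Kᵀ.mulVec β = -Yᵀ.mulVec v := by
      rw [hβ, Matrix.mulVec_neg, Matrix.mulVec_mulVec, Matrix.mul_nonsing_inv _ hdet,
        Matrix.one_mulVec]
    set w := v + U.mulVec β with hw
    have hYw : Yᵀ.mulVec w = 0 := by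
      have : Yᵀ * U = Kᵀ := by rw [hK, Matrix.transpose_mul, Matrix.transpose_transpose]
      rw [hw, Matrix.mulVec_add, Matrix.mulVec_mulVec, this, hKβ]; simp
    have hvU : ∀ z : Fin d → ℝ, v ⬝ᵥ U.mulVec z = 0 := by
      intro z; rw [Matrix.dotProduct_mulVec, ← Matrix.mulVec_transpose, h1, zero_dotProduct]
    have hUv : ∀ z : Fin d → ℝ, U.mulVec z ⬝ᵥ v = 0 := fun z => by rw [dotProduct_comm, hvU]
    have hww : w ⬝ᵥ w = v ⬝ᵥ v + β ⬝ᵥ β := by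
      rw [hw, add_dotProduct, dotProduct_add, dotProduct_add, hvU, hUv, orth_dot h.orth]; ring
    have hAw : w ⬝ᵥ A.mulVec w = mu * (v ⬝ᵥ v) + β ⬝ᵥ (diagonal lam).mulVec β := by
      have e : A.mulVec w = mu • v + U.mulVec ((diagonal lam).mulVec β) := by
        rw [hw, Matrix.mulVec_add, h2, Matrix.mulVec_mulVec, h.eig, ← Matrix.mulVec_mulVec]
      rw [e, hw, add_dotProduct, dotProduct_add, dotProduct_add, hvU, dotProduct_smul,
        dotProduct_smul, hUv, Matrix.dotProduct_mulVec (U.mulVec β), ← Matrix.mulVec_transpose,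
        Matrix.mulVec_mulVec, h.orth, Matrix.one_mulVec]
      simp
    have q := (abs_le.1 (hE.quad hτ w)).2
    have q2 := hquad w
    rw [hYw, zero_dotProduct, zero_add, hAw] at q2
    have q3 := diag_quad_lower lam (g - τ) (h.lam_lower hA Y hτ hE hg hg0 hgt) β
    have q4 := dot_self_nonneg β
    rw [hww] at q
    have : mu * (v ⬝ᵥ v) ≤ τ * (v ⬝ᵥ v) := by nlinarith
    exact le_of_mul_le_mul_right this hvv

end DetPart

section DetMain
open scoped Matrix.Norms.Frobenius

lemma exists_polar {d : ℕ} (K : Matrix (Fin d) (Fin d) ℝ) (h : (K * Kᵀ).PosDef) :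
    ∃ R Q : Matrix (Fin d) (Fin d) ℝ, Rᵀ = R ∧ (∀ w : Fin d → ℝ, 0 ≤ w ⬝ᵥ R.mulVec w) ∧
      R * R = K * Kᵀ ∧ Qᵀ * Q = 1 ∧ K = R * Q := by
  have hsym : (K * Kᵀ)ᵀ = K * Kᵀ := by simp [Matrix.transpose_mul]
  obtain ⟨V, x, v1, v2, v3⟩ := spec_exists _ hsym
  have hx : ∀ k, 0 ≤ x k := by
    intro k
    have h1 := h.posSemidef.dotProduct_mulVec_nonneg (fun i => V i k)
    have e : x k = (Vᵀ * (K * Kᵀ) * V) k k := by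
      rw [v3]
      have : Vᵀ * (V * diagonal x * Vᵀ) * V = (Vᵀ * V) * diagonal x * (Vᵀ * V) := by
        simp only [Matrix.mul_assoc]
      rw [this, v1]; simp
    have e2 : (Vᵀ * (K * Kᵀ) * V) k k = (fun i => V i k) ⬝ᵥ (K * Kᵀ).mulVec (fun i => V i k) := by
      rw [Matrix.mul_assoc, Matrix.mul_apply]; rfl
    rw [e, e2]; simpa using h1
  let R := V * diagonal (fun k => Real.sqrt (x k)) * Vᵀ
  have hRR : R * R = K * Kᵀ := by
    have : R * R = V * (diagonal (fun k => Real.sqrt (x k)) * (Vᵀ * V) *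
        diagonal (fun k => Real.sqrt (x k))) * Vᵀ := by simp only [R, Matrix.mul_assoc]
    rw [this, v1, Matrix.mul_one, diagonal_mul_diagonal, v3]
    simp only [Real.mul_self_sqrt (hx _)]
  have hRt : Rᵀ = R := by simp [R, Matrix.transpose_mul, Matrix.mul_assoc]
  have hdet : IsUnit R.det := by
    have := h.det_pos
    rw [← hRR, Matrix.det_mul] at this
    exact isUnit_iff_ne_zero.2 (fun h0 => by rw [h0] at this; simp at this)
  refine ⟨R, R⁻¹ * K, hRt, ?_, hRR, ?_, ?_⟩
  · intro w
    have : w ⬝ᵥ R.mulVec w = Vᵀ.mulVec w ⬝ᵥ (diagonal (fun k => Real.sqrt (x k))).mulVec (Vᵀ.mulVec w) := by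
      rw [show R = V * (diagonal (fun k => Real.sqrt (x k)) * Vᵀ) from Matrix.mul_assoc _ _ _,
        ← Matrix.mulVec_mulVec, ← Matrix.mulVec_mulVec, Matrix.dotProduct_mulVec w,
        ← Matrix.mulVec_transpose]
    rw [this]
    have := diag_quad_lower (fun k => Real.sqrt (x k)) 0 (fun _ => Real.sqrt_nonneg _) (Vᵀ.mulVec w)
    simpa using this
  · -- (Q Qᵀ = 1 then Qᵀ Q = 1)
    rw [_root_.mul_eq_one_comm, Matrix.transpose_mul, Matrix.transpose_nonsing_inv, hRt]
    calc R⁻¹ * K * (Kᵀ * R⁻¹) = R⁻¹ * (K * Kᵀ) * R⁻¹ := by simp only [Matrix.mul_assoc]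
      _ = (R⁻¹ * R) * (R * R⁻¹) := by rw [← hRR]; simp only [Matrix.mul_assoc]
      _ = 1 := by rw [Matrix.nonsing_inv_mul _ hdet, Matrix.mul_nonsing_inv _ hdet, Matrix.one_mul]
  · rw [← Matrix.mul_assoc, Matrix.mul_nonsing_inv _ hdet, Matrix.one_mul]

lemma trace_quad_lower {d e : ℕ} (S : Matrix (Fin d) (Fin d) ℝ) (c : ℝ)
    (h : ∀ w : Fin d → ℝ, c * (w ⬝ᵥ w) ≤ w ⬝ᵥ S.mulVec w) (B : Matrix (Fin d) (Fin e) ℝ) :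
    c * ‖B‖ ^ 2 ≤ (Bᵀ * S * B).trace := by
  rw [fro_sq, Finset.sum_comm, Finset.mul_sum, Matrix.trace]
  refine Finset.sum_le_sum fun j _ => ?_
  have := h (fun i => B i j)
  rw [Matrix.diag_apply, Matrix.mul_assoc, Matrix.mul_apply]
  refine le_trans (le_of_eq ?_) this
  simp [dotProduct, pow_two]

/-- perturbation of square roots -/
lemma sqrt_pert {d : ℕ} (s : Fin d → ℝ) (c : ℝ) (hc : 0 < c) (hs : ∀ j, c ≤ s j)
    (R : Matrix (Fin d) (Fin d) ℝ) (hR : Rᵀ = R) (hR0 : ∀ w : Fin d → ℝ, 0 ≤ w ⬝ᵥ R.mulVec w) :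
    c * ‖diagonal s - R‖ ≤ ‖diagonal s * diagonal s - R * R‖ := by
  set Δ := diagonal s - R with hΔ
  have hΔt : Δᵀ = Δ := by simp [hΔ, hR]
  have e : diagonal s * diagonal s - R * R = diagonal s * Δ + Δ * R := by
    rw [hΔ]; noncomm_ring
  have h1 := trace_le_fro Δ (diagonal s * diagonal s - R * R)
  rw [e, hΔt, Matrix.mul_add, Matrix.trace_add] at h1
  have h2 := trace_quad_lower (diagonal s) c (fun w => diag_quad_lower s c hs w) Δ
  have h3 := trace_quad_lower R 0 (fun w => by simpa using hR0 w) Δ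
  rw [hΔt] at h2 h3
  have h4 : (Δ * (Δ * R)).trace = (Δ * R * Δ).trace := Matrix.trace_mul_comm _ _
  rw [h4] at h1
  rw [← Matrix.mul_assoc] at h1
  rw [← e] at h1
  rcases (norm_nonneg Δ).eq_or_lt with h0 | h0
  · rw [← h0, mul_zero]; exact norm_nonneg _
  · have : (c * ‖Δ‖) * ‖Δ‖ ≤ ‖diagonal s * diagonal s - R * R‖ * ‖Δ‖ := by nlinarith
    exact le_of_mul_le_mul_right this h0

lemma det_main {n d : ℕ} {A : Matrix (Fin n) (Fin n) ℝ} {U : Matrix (Fin n) (Fin d) ℝ}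
    {lam : Fin d → ℝ} (h : TopEig A U lam) (hA : Aᵀ = A) (Y : Matrix (Fin n) (Fin d) ℝ)
    {τ g : ℝ} (hτ : 0 ≤ τ) (hE : OpLe (A - Y * Yᵀ) τ)
    (hg : ∀ w : Fin d → ℝ, g * (w ⬝ᵥ w) ≤ Y.mulVec w ⬝ᵥ Y.mulVec w) (hg0 : 0 < g)
    (hgt : 4 * τ ≤ g) :
    ∃ Q : Matrix (Fin d) (Fin d) ℝ, Qᵀ * Q = 1 ∧ ∃ δ : ℝ, 0 ≤ δ ∧
      δ ≤ (d : ℝ) ^ 2 * τ / Real.sqrt (g / 2) + (1 + d) * τ * ‖Y‖ / (g / 2) ∧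
      ∀ i, g / 2 * euclNorm ((U * diagonal (fun j => Real.sqrt |lam j|) * Q - Y) i) ≤
        euclNorm (Y i) * (δ * (‖Y‖ + δ)) + euclNorm (((A - Y * Yᵀ) * Y) i) + τ * δ := by
  set E := A - Y * Yᵀ with hEdef
  set K := Uᵀ * Y with hK
  have hlam := h.lam_lower hA Y hτ hE hg hg0 hgt
  have hlam2 : ∀ j, g / 2 ≤ lam j := fun j => by linarith [hlam j]
  have hpd : (K * Kᵀ).PosDef := posDef_of_lower _ (by simp [Matrix.transpose_mul]) (g - 2 * τ)
      (by linarith) (h.KKt_lower hA Y hτ hE hg hg0 hgt)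
  obtain ⟨R, Q, hRt, hR0, hRR, hQ, hKRQ⟩ := exists_polar K hpd
  set s : Fin d → ℝ := fun j => Real.sqrt |lam j| with hs
  have hss : diagonal s * diagonal s = diagonal lam := by
    rw [diagonal_mul_diagonal]; congr 1; ext j
    rw [hs]; simp only
    rw [Real.mul_self_sqrt (abs_nonneg _), abs_of_nonneg (by linarith [hlam2 j])]
  have hsg : ∀ j, Real.sqrt (g / 2) ≤ s j := fun j =>
    Real.sqrt_le_sqrt ((hlam2 j).trans (le_abs_self _))
  have hUn : ‖U‖ ^ 2 = d := fro_orth h.orth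
  have hQn : ‖Q‖ ^ 2 = d := fro_orth hQ
  have hUQ : ‖U‖ = ‖Q‖ := by
    have : ‖U‖ ^ 2 = ‖Q‖ ^ 2 := by rw [hUn, hQn]
    exact (pow_left_inj₀ (norm_nonneg _) (norm_nonneg _) two_ne_zero).1 this
  -- Δ
  set Δ := diagonal s - R with hΔ
  have hsqg : 0 < Real.sqrt (g / 2) := Real.sqrt_pos.2 (by linarith)
  have hΔb : Real.sqrt (g / 2) * ‖Δ‖ ≤ d * τ := by
    refine (sqrt_pert s _ hsqg hsg R hRt hR0).trans ?_
    have : diagonal s * diagonal s - R * R = Uᵀ * (E * U) := by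
      rw [hss, hRR, h.KKt_eq, Matrix.mul_assoc, hEdef]; simp
    rw [this]
    calc ‖Uᵀ * (E * U)‖ ≤ ‖Uᵀ‖ * ‖E * U‖ := Matrix.frobenius_norm_mul _ _
      _ ≤ ‖U‖ * (τ * ‖U‖) := by
          rw [Matrix.frobenius_norm_transpose]
          exact mul_le_mul_of_nonneg_left (hE.fro hτ U) (norm_nonneg _)
      _ = d * τ := by rw [← hUn]; ring
  -- Θ
  set Θ := Y - U * K with hΘ
  have hΘb : g / 2 * ‖Θ‖ ≤ (1 + d) * τ * ‖Y‖ := by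
    have hres := h.resid hA Y hτ hE hg hg0 hgt
    set A' := A - U * diagonal lam * Uᵀ with hA'
    have hAE : A = Y * Yᵀ + E := by rw [hEdef]; simp
    have hA'U : A' * U = 0 := by
      rw [hA', Matrix.sub_mul, h.eig, Matrix.mul_assoc (U * diagonal lam), h.orth, Matrix.mul_one,
        sub_self]
    have e1 : diagonal lam * K = K * (Yᵀ * Y) + Uᵀ * (E * Y) := by
      rw [hK, ← Matrix.mul_assoc, ← h.eigT hA, hAE]
      simp only [Matrix.mul_add, Matrix.add_mul, Matrix.mul_assoc]
    have e2 : Θ * (Yᵀ * Y) = A' * Θ - E * Y + U * (Uᵀ * (E * Y)) := by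
      have : A' * Θ = A * Y - U * (diagonal lam * K) := by
        rw [hΘ, Matrix.mul_sub, ← Matrix.mul_assoc, hA'U, Matrix.zero_mul, sub_zero, hA',
          Matrix.sub_mul, hK]; simp only [Matrix.mul_assoc]
      have hAY : A * Y = Y * (Yᵀ * Y) + E * Y := by
        rw [hAE, Matrix.add_mul, Matrix.mul_assoc]
      rw [this, e1, hΘ, hAY]
      rw [Matrix.sub_mul, Matrix.mul_add]; simp only [Matrix.mul_assoc]; abel
    have e3 : g * ‖Θ‖ ≤ ‖Θ * (Yᵀ * Y)‖ := by
      refine fro_lower (Yᵀ * Y) g hg0.le (fun w => ?_) Θ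
      refine (hg w).trans (le_of_eq ?_)
      rw [Matrix.dotProduct_mulVec, ← Matrix.mulVec_transpose, Matrix.mulVec_mulVec, dotProduct_comm]
    have e4 : ‖Θ * (Yᵀ * Y)‖ ≤ τ * ‖Θ‖ + τ * ‖Y‖ + d * (τ * ‖Y‖) := by
      rw [e2]
      have n1 := hres.fro hτ Θ
      have n2 := hE.fro hτ Y
      have n3 : ‖U * (Uᵀ * (E * Y))‖ ≤ d * (τ * ‖Y‖) := by
        calc ‖U * (Uᵀ * (E * Y))‖ ≤ ‖U‖ * ‖Uᵀ * (E * Y)‖ := Matrix.frobenius_norm_mul _ _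
          _ ≤ ‖U‖ * (‖Uᵀ‖ * ‖E * Y‖) := mul_le_mul_of_nonneg_left (Matrix.frobenius_norm_mul _ _) (norm_nonneg _)
          _ = d * ‖E * Y‖ := by rw [Matrix.frobenius_norm_transpose, ← hUn]; ring
          _ ≤ _ := mul_le_mul_of_nonneg_left n2 (by positivity)
      calc _ ≤ ‖A' * Θ - E * Y‖ + ‖U * (Uᵀ * (E * Y))‖ := norm_add_le _ _
        _ ≤ (‖A' * Θ‖ + ‖E * Y‖) + ‖U * (Uᵀ * (E * Y))‖ := by gcongr; exact norm_sub_le _ _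
        _ ≤ _ := by gcongr
    nlinarith [norm_nonneg Θ]
  -- D
  set X := U * diagonal s * Q with hX
  set D := X - Y with hD
  have hDeq : D = U * (Δ * Q) - Θ := by
    have hUK : U * K = U * (R * Q) := by rw [← hKRQ]
    rw [hD, hX, hΘ, hUK, hΔ]
    simp only [Matrix.mul_sub, Matrix.sub_mul, Matrix.mul_add, Matrix.add_mul, Matrix.mul_assoc]; abel
  have hDb : ‖D‖ ≤ (d : ℝ) ^ 2 * τ / Real.sqrt (g / 2) + (1 + d) * τ * ‖Y‖ / (g / 2) := by
    rw [hDeq]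
    refine (norm_sub_le _ _).trans (add_le_add ?_ ?_)
    · rw [le_div_iff₀ hsqg]
      have : ‖U * (Δ * Q)‖ ≤ d * ‖Δ‖ := by
        calc ‖U * (Δ * Q)‖ ≤ ‖U‖ * ‖Δ * Q‖ := Matrix.frobenius_norm_mul _ _
          _ ≤ ‖U‖ * (‖Δ‖ * ‖Q‖) := mul_le_mul_of_nonneg_left (Matrix.frobenius_norm_mul _ _) (norm_nonneg _)
          _ = d * ‖Δ‖ := by rw [← hUQ, ← hUn]; ring
      have hd : (0:ℝ) ≤ d := by positivity
      calc ‖U * (Δ * Q)‖ * Real.sqrt (g / 2) ≤ d * ‖Δ‖ * Real.sqrt (g / 2) := by gcongr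
        _ = d * (Real.sqrt (g / 2) * ‖Δ‖) := by ring
        _ ≤ d * (d * τ) := by gcongr
        _ = _ := by ring
    · rw [le_div_iff₀ (by linarith)]; linarith
  refine ⟨Q, hQ, ‖D‖, norm_nonneg _, hDb, fun i => ?_⟩
  have hXX : Xᵀ * X = Qᵀ * (diagonal lam * Q) := by
    rw [hX]
    simp only [Matrix.transpose_mul, diagonal_transpose]
    calc Qᵀ * (diagonal s * Uᵀ) * (U * diagonal s * Q)
        = Qᵀ * (diagonal s * (Uᵀ * U) * diagonal s * Q) := by simp only [Matrix.mul_assoc]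
      _ = _ := by rw [h.orth, Matrix.mul_one, hss]
  have hAX : A * X = X * (Xᵀ * X) := by
    have hQQ : Q * Qᵀ = 1 := _root_.mul_eq_one_comm.1 hQ
    rw [hXX, hX, ← Matrix.mul_assoc, ← Matrix.mul_assoc, h.eig]
    have : U * diagonal s * Q * (Qᵀ * (diagonal lam * Q)) = U * diagonal s * (Q * Qᵀ) * diagonal lam * Q := by
      simp only [Matrix.mul_assoc]
    have hcomm : diagonal lam * diagonal s = diagonal s * diagonal lam := by
      rw [diagonal_mul_diagonal, diagonal_mul_diagonal]; simp only [mul_comm]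
    rw [this, hQQ, Matrix.mul_one, Matrix.mul_assoc U, Matrix.mul_assoc U, hcomm]
    simp only [Matrix.mul_assoc]
  have hDS : D * (Xᵀ * X) = -(Y * (Dᵀ * X)) + E * Y + E * D := by
    have hDt : Dᵀ = Xᵀ - Yᵀ := by rw [hD, Matrix.transpose_sub]
    have : D * (Xᵀ * X) = A * X - Y * (Xᵀ * X) := by rw [hAX, hD, Matrix.sub_mul]
    rw [this, hDt, hEdef, hD]
    simp only [Matrix.mul_sub, Matrix.sub_mul, Matrix.mul_add, Matrix.add_mul, Matrix.mul_assoc]; abel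
  have hlow := row_lower (Xᵀ * X) (g / 2) (fun w => by
    rw [hXX, ← Matrix.mulVec_mulVec, ← Matrix.mulVec_mulVec, Matrix.dotProduct_mulVec w,
      ← Matrix.mulVec_transpose, Matrix.transpose_transpose, ← orth_dot hQ w]
    exact diag_quad_lower lam _ hlam2 _) (D i)
  refine hlow.trans ?_
  have hrow : D i ᵥ* (Xᵀ * X) = -(Y i ᵥ* (Dᵀ * X)) + (E * Y) i + (E * D) i := by
    have := congrFun hDS i
    exact this
  rw [hrow]
  refine (eucl_add_le _ _).trans (add_le_add ((eucl_add_le _ _).trans (add_le_add ?_ le_rfl)) ?_)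
  · rw [eucl_neg]
    refine (eucl_vecMul_le _ _).trans (mul_le_mul_of_nonneg_left ?_ (eucl_nonneg _))
    refine (Matrix.frobenius_norm_mul _ _).trans ?_
    rw [Matrix.frobenius_norm_transpose]
    refine mul_le_mul_of_nonneg_left ?_ (norm_nonneg _)
    have : X = Y + D := by rw [hD]; simp
    rw [this]; exact norm_add_le _ _
  · exact (eucl_row_le _ _).trans (hE.fro hτ D)

end DetMain

section ASE

lemma ase_exists {n d : ℕ} (A : Fin n → Fin n → ℝ) (hA : (Matrix.of A)ᵀ = Matrix.of A)
    (hdn : d ≤ n) : ∃ Xh : Fin n → Fin d → ℝ, IsASE A Xh := by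
  obtain ⟨U, x, u1, u2, u3⟩ := spec_exists (Matrix.of A) hA
  set σ := Tuple.sort (fun k => -|x k|) with hσ
  have hmono : Monotone ((fun k => -|x k|) ∘ σ) := Tuple.monotone_sort _
  set c : Fin d → Fin n := fun j => σ (Fin.castLE hdn j) with hc
  have hcinj : Function.Injective c := fun a b hab =>
    Fin.castLE_injective hdn (σ.injective hab)
  refine ⟨fun i j => U i (c j) * Real.sqrt |x (c j)|, fun j => x (c j), fun i j => U i (c j),
    ?_, ?_, ?_, fun _ _ => rfl⟩
  · intro j j'
    have := congrFun (congrFun u1 (c j)) (c j')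
    rw [Matrix.mul_apply] at this
    simp only [Matrix.transpose_apply] at this
    rw [this, Matrix.one_apply]
    simp [hcinj.eq_iff]
  · intro j
    have h1 : Matrix.of A * U = U * diagonal x := by
      rw [u3, Matrix.mul_assoc, u1, Matrix.mul_one]
    ext i
    have := congrFun (congrFun h1 i) (c j)
    rw [Matrix.mul_apply, Matrix.mul_diagonal, mul_comm] at this
    exact this
  · intro mu v hv hAv hperp j
    set w := Uᵀ.mulVec v with hw
    have hvw : v = U.mulVec w := by rw [hw, Matrix.mulVec_mulVec, u2, Matrix.one_mulVec]
    have hxw : ∀ k, x k * w k = mu * w k := by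
      have : (diagonal x).mulVec w = mu • w := by
        have h2 : Uᵀ.mulVec ((Matrix.of A).mulVec v) = (diagonal x).mulVec w := by
          rw [u3, Matrix.mulVec_mulVec, hw, Matrix.mulVec_mulVec]
          congr 1
          rw [← Matrix.mul_assoc, ← Matrix.mul_assoc, u1, Matrix.one_mul]
        rw [← h2, hAv, Matrix.mulVec_smul]
      intro k
      have := congrFun this k
      rwa [Matrix.mulVec_diagonal] at this
    have hw0 : w ≠ 0 := fun h0 => hv (by rw [hvw, h0, Matrix.mulVec_zero])
    obtain ⟨k, hk⟩ := Function.ne_iff.1 hw0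
    have hk' : w k ≠ 0 := hk
    have hxk : x k = mu := mul_right_cancel₀ hk' (hxw k)
    have hwc : ∀ j, w (c j) = 0 := by
      intro j
      have := hperp j
      rw [← this, hw]
      simp [Matrix.mulVec, dotProduct, mul_comm]
    set m := σ.symm k with hm
    have hle : Fin.castLE hdn j ≤ m := by
      by_contra hlt
      push Not at hlt
      have : (m : ℕ) < d := lt_trans hlt j.2
      apply hk'
      have h3 := hwc ⟨m, this⟩
      have h4 : c ⟨m, this⟩ = k := by
        rw [hc]; simp only
        have : Fin.castLE hdn ⟨m, this⟩ = m := rfl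
        rw [this, hm, Equiv.apply_symm_apply]
      rwa [h4] at h3
    have := hmono hle
    simp only [Function.comp, hm, Equiv.apply_symm_apply] at this
    rw [hxk] at this
    show |mu| ≤ |x (c j)|
    rw [hc]; linarith

lemma ase_spec {n d : ℕ} (A : Fin n → Fin n → ℝ) (hA : (Matrix.of A)ᵀ = Matrix.of A)
    (hdn : d ≤ n) : ∃ (U : Matrix (Fin n) (Fin d) ℝ) (lam : Fin d → ℝ),
      TopEig (Matrix.of A) U lam ∧
      Matrix.of (ase d A) = U * diagonal (fun j => Real.sqrt |lam j|) := by
  have h : ∃ Xh : Fin n → Fin d → ℝ, IsASE A Xh := ase_exists A hA hdn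
  have h1 : IsASE A (ase d A) := by rw [ase, dif_pos h]; exact h.choose_spec
  obtain ⟨lam, U, h2, h3, h4, h5⟩ := h1
  refine ⟨Matrix.of U, lam, ⟨?_, ?_, ?_⟩, ?_⟩
  · ext j j'
    rw [Matrix.mul_apply, Matrix.one_apply, ← h2 j j']; rfl
  · ext i j
    rw [Matrix.mul_diagonal, mul_comm]
    exact congrFun (h3 j) i
  · intro mu v hv hAv hp j
    refine h4 mu v hv hAv (fun j => ?_) j
    have := congrFun hp j
    simp only [Matrix.mulVec, dotProduct, Matrix.transpose_apply, Matrix.of_apply, Pi.zero_apply] at this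
    rw [← this]
    exact Finset.sum_congr rfl fun i _ => mul_comm _ _
  · ext i j
    rw [Matrix.mul_diagonal]
    exact h5 i j

end ASE

section BernProd
variable {ι : Type*} [Fintype ι] [DecidableEq ι]

/-- weight of a configuration under independent Bernoulli variables -/
def bw (p : ι → ℝ) (ω : ι → Bool) : ℝ := ∏ e, (if ω e = true then p e else 1 - p e)

/-- expectation under independent Bernoulli variables -/
def Ex (p : ι → ℝ) (g : (ι → Bool) → ℝ) : ℝ := ∑ ω, bw p ω * g ω

lemma bw_nonneg {p : ι → ℝ} (hp : ∀ e, 0 ≤ p e ∧ p e ≤ 1) (ω : ι → Bool) : 0 ≤ bw p ω := by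
  refine Finset.prod_nonneg fun e _ => ?_
  split_ifs
  · exact (hp e).1
  · linarith [(hp e).2]

lemma Ex_mono {p : ι → ℝ} (hp : ∀ e, 0 ≤ p e ∧ p e ≤ 1) {f g : (ι → Bool) → ℝ}
    (h : ∀ ω, f ω ≤ g ω) : Ex p f ≤ Ex p g :=
  Finset.sum_le_sum fun ω _ => mul_le_mul_of_nonneg_left (h ω) (bw_nonneg hp ω)

lemma Ex_add (p : ι → ℝ) (f g : (ι → Bool) → ℝ) :
    Ex p (fun ω => f ω + g ω) = Ex p f + Ex p g := by
  simp only [Ex, mul_add, Finset.sum_add_distrib]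

lemma Ex_smul (p : ι → ℝ) (c : ℝ) (f : (ι → Bool) → ℝ) :
    Ex p (fun ω => c * f ω) = c * Ex p f := by
  simp only [Ex, Finset.mul_sum]
  exact Finset.sum_congr rfl fun ω _ => by ring

lemma Ex_sum {κ : Type*} (p : ι → ℝ) (s : Finset κ) (f : κ → (ι → Bool) → ℝ) :
    Ex p (fun ω => ∑ k ∈ s, f k ω) = ∑ k ∈ s, Ex p (f k) := by
  simp only [Ex, Finset.mul_sum]
  rw [Finset.sum_comm]

lemma Ex_one (p : ι → ℝ) : Ex p (fun _ => 1) = 1 := by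
  simp only [Ex, bw, mul_one]
  have := Finset.prod_univ_sum (fun _ : ι => (Finset.univ : Finset Bool))
    (fun e b => if b = true then p e else 1 - p e)
  simp only [Fintype.piFinset_univ] at this
  rw [← this]
  simp

lemma bw_update (p : ι → ℝ) (ω : ι → Bool) (e : ι) (b : Bool) :
    bw p (Function.update ω e b) = (if b = true then p e else 1 - p e) *
      ∏ x ∈ Finset.univ.erase e, (if ω x = true then p x else 1 - p x) := by
  rw [bw, ← Finset.mul_prod_erase Finset.univ _ (Finset.mem_univ e)]
  congr 1
  · simp
  · refine Finset.prod_congr rfl fun x hx => ?_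
    rw [Function.update_of_ne (Finset.ne_of_mem_erase hx)]

lemma Ex_step (p : ι → ℝ) (e : ι) (g : (ι → Bool) → ℝ) :
    Ex p g = Ex p (fun ω => p e * g (Function.update ω e true) +
      (1 - p e) * g (Function.update ω e false)) := by
  have hinv : ∀ ω : ι → Bool, Function.update (Function.update ω e (!ω e)) e
      (!(Function.update ω e (!ω e)) e) = ω := by
    intro ω; simp
  let fl : (ι → Bool) ≃ (ι → Bool) :=
    ⟨fun ω => Function.update ω e (!ω e), fun ω => Function.update ω e (!ω e), hinv, hinv⟩
  have key : ∀ F : (ι → Bool) → ℝ, 2 * ∑ ω, F ω = ∑ ω, (F ω + F (fl ω)) := by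
    intro F
    rw [Finset.sum_add_distrib, Equiv.sum_comp fl F]; ring
  have : 2 * Ex p g = 2 * Ex p (fun ω => p e * g (Function.update ω e true) +
      (1 - p e) * g (Function.update ω e false)) := by
    unfold Ex
    rw [key, key]
    refine Finset.sum_congr rfl fun ω _ => ?_
    have hfl : fl ω = Function.update ω e (!ω e) := rfl
    have h0 : bw p ω = bw p (Function.update ω e (ω e)) := by rw [Function.update_eq_self]
    rw [hfl, h0, bw_update, bw_update]
    simp only [Function.update_idem]
    have h1 : g ω = g (Function.update ω e (ω e)) := by rw [Function.update_eq_self]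
    rw [h1]
    cases ω e <;> simp <;> ring
  linarith

lemma Ex_prod_le {κ : Type*} {p : ι → ℝ} (hp : ∀ e, 0 ≤ p e ∧ p e ≤ 1) (φ : κ → ι)
    (f : κ → Bool → ℝ) (c : κ → ℝ) (hf : ∀ k b, 0 ≤ f k b) (s : Finset κ)
    (hφ : Set.InjOn φ s)
    (hc : ∀ k ∈ s, p (φ k) * f k true + (1 - p (φ k)) * f k false ≤ c k) :
    Ex p (fun ω => ∏ k ∈ s, f k (ω (φ k))) ≤ ∏ k ∈ s, c k := by
  induction s using Finset.induction_on with
  | empty => simp [Ex_one]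
  | insert a s ha ih =>
    have ih' := ih (hφ.mono (by simp)) (fun k hk => hc k (Finset.mem_insert_of_mem hk))
    rw [Ex_step p (φ a), Finset.prod_insert ha]
    have hne : ∀ k ∈ s, φ k ≠ φ a := fun k hk hh => ha (by
      have := hφ (by simp [hk]) (by simp) hh
      rwa [← this])
    have hupd : ∀ (ω : ι → Bool) b, ∏ k ∈ insert a s, f k (Function.update ω (φ a) b (φ k)) =
        f a b * ∏ k ∈ s, f k (ω (φ k)) := by
      intro ω b
      rw [Finset.prod_insert ha]
      congr 1
      · simp
      · exact Finset.prod_congr rfl fun k hk => by rw [Function.update_of_ne (hne k hk)]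
    have hca := hc a (Finset.mem_insert_self _ _)
    have hpr : ∀ ω : ι → Bool, 0 ≤ ∏ k ∈ s, f k (ω (φ k)) := fun ω =>
      Finset.prod_nonneg fun k _ => hf _ _
    have hEx0 : 0 ≤ Ex p (fun ω => ∏ k ∈ s, f k (ω (φ k))) :=
      Finset.sum_nonneg fun ω _ => mul_nonneg (bw_nonneg hp ω) (hpr ω)
    have hc0 : 0 ≤ c a := le_trans (add_nonneg (mul_nonneg (hp _).1 (hf _ _))
      (mul_nonneg (by linarith [(hp (φ a)).2]) (hf _ _))) hca
    calc _ ≤ Ex p (fun ω => c a * ∏ k ∈ s, f k (ω (φ k))) := by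
          refine Ex_mono hp fun ω => ?_
          rw [hupd, hupd]
          nlinarith [hpr ω]
      _ = c a * Ex p (fun ω => ∏ k ∈ s, f k (ω (φ k))) := Ex_smul _ _ _
      _ ≤ _ := mul_le_mul_of_nonneg_left ih' hc0

/-- probability of an event -/
def Pr (p : ι → ℝ) (S : Set (ι → Bool)) : ℝ := Ex p (fun ω => if ω ∈ S then 1 else 0)

lemma Pr_union_le {p : ι → ℝ} (hp : ∀ e, 0 ≤ p e ∧ p e ≤ 1) (S T : Set (ι → Bool)) :
    Pr p (S ∪ T) ≤ Pr p S + Pr p T := by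
  unfold Pr
  rw [← Ex_add]
  refine Ex_mono hp fun ω => ?_
  by_cases h1 : ω ∈ S <;> by_cases h2 : ω ∈ T <;> simp [h1, h2]

lemma Pr_iUnion_le {κ : Type*} [Fintype κ] {p : ι → ℝ} (hp : ∀ e, 0 ≤ p e ∧ p e ≤ 1)
    (S : κ → Set (ι → Bool)) : Pr p (⋃ k, S k) ≤ ∑ k, Pr p (S k) := by
  unfold Pr
  rw [← Ex_sum]
  refine Ex_mono hp fun ω => ?_
  split_ifs with h
  · obtain ⟨k, hk⟩ := Set.mem_iUnion.1 h
    have := Finset.single_le_sum (f := fun k => if ω ∈ S k then (1:ℝ) else 0)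
      (fun k _ => by split_ifs <;> norm_num) (Finset.mem_univ k)
    simpa [hk] using this
  · exact Finset.sum_nonneg fun k _ => by split_ifs <;> norm_num

lemma Pr_mono {p : ι → ℝ} (hp : ∀ e, 0 ≤ p e ∧ p e ≤ 1) {S T : Set (ι → Bool)} (h : S ⊆ T) :
    Pr p S ≤ Pr p T := by
  refine Ex_mono hp fun ω => ?_
  by_cases h1 : ω ∈ S
  · simp [h1, h h1]
  · simp only [h1, if_false]; split_ifs <;> norm_num

/-- Markov -/
lemma Pr_markov {p : ι → ℝ} (hp : ∀ e, 0 ≤ p e ∧ p e ≤ 1) (f : (ι → Bool) → ℝ)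
    (hf : ∀ ω, 0 ≤ f ω) (t : ℝ) : t * Pr p {ω | t ≤ f ω} ≤ Ex p f := by
  unfold Pr
  rw [← Ex_smul]
  refine Ex_mono hp fun ω => ?_
  by_cases h : t ≤ f ω <;> simp [h, hf ω]

lemma transfer {p : ι → ℝ} (hp : ∀ e, 0 ≤ p e ∧ p e ≤ 1) (S : Set (ι → Bool)) :
    (Measure.pi fun _ : ι => (volume.restrict (Set.Icc (0:ℝ) 1)))
      {u | (fun e => decide (u e < p e)) ∈ S} ≤ ENNReal.ofReal (Pr p S) := by
  have hsub : {u : ι → ℝ | (fun e => decide (u e < p e)) ∈ S} ⊆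
      ⋃ ω ∈ (Finset.univ.filter (fun ω : ι → Bool => ω ∈ S)),
        Set.pi Set.univ (fun e => {x : ℝ | decide (x < p e) = ω e}) := by
    intro u hu
    simp only [Set.mem_iUnion]
    exact ⟨fun e => decide (u e < p e), by simpa using hu, by simp⟩
  refine (measure_mono hsub).trans ((measure_biUnion_finset_le _ _).trans ?_)
  have hone : ∀ (ω : ι → Bool) e, (volume.restrict (Set.Icc (0:ℝ) 1)) {x : ℝ | decide (x < p e) = ω e}
      ≤ ENNReal.ofReal (if ω e = true then p e else 1 - p e) := by
    intro ω e
    rw [Measure.restrict_apply' measurableSet_Icc]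
    cases hω : ω e
    · simp only [decide_eq_false_iff_not, not_lt, Bool.false_eq_true, if_false]
      refine (measure_mono (t := Set.Icc (p e) 1) ?_).trans (by simp)
      rintro x ⟨h1, h2⟩; exact ⟨h1, h2.2⟩
    · simp only [decide_eq_true_eq, if_true]
      refine (measure_mono (t := Set.Icc 0 (p e)) ?_).trans (by simp)
      rintro x ⟨h1, h2⟩; exact ⟨h2.1, le_of_lt h1⟩
  calc _ ≤ ∑ ω ∈ Finset.univ.filter (fun ω : ι → Bool => ω ∈ S), ENNReal.ofReal (bw p ω) := by
        refine Finset.sum_le_sum fun ω _ => ?_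
        rw [Measure.pi_pi, bw, ENNReal.ofReal_prod_of_nonneg]
        · exact Finset.prod_le_prod' fun e _ => hone ω e
        · intro e _
          split_ifs
          · exact (hp e).1
          · linarith [(hp e).2]
    _ = ENNReal.ofReal (Pr p S) := by
        rw [← ENNReal.ofReal_sum_of_nonneg (fun ω _ => bw_nonneg hp ω)]
        congr 1
        simp [Pr, Ex, Finset.sum_filter]

end BernProd

section SpecBound
variable {n : ℕ}

/-- the unordered edge -/
def edg (i j : Fin n) : Fin n × Fin n := (min i j, max i j)

lemma edg_comm (i j : Fin n) : edg i j = edg j i := by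
  simp [edg, min_comm, max_comm]

lemma edg_eq_iff (i j a b : Fin n) : edg a b = edg i j ↔ (a = i ∧ b = j) ∨ (a = j ∧ b = i) := by
  simp only [edg, Prod.mk.injEq]
  constructor
  · rintro ⟨h1, h2⟩
    rcases le_total a b with h | h <;> rcases le_total i j with h' | h' <;>
      simp only [min_eq_left h, max_eq_right h, min_eq_right h, max_eq_left h, min_eq_left h',
        max_eq_right h', min_eq_right h', max_eq_left h'] at h1 h2 <;> simp [h1, h2]
  · rintro (⟨rfl, rfl⟩ | ⟨rfl, rfl⟩)
    · simp
    · simp [min_comm, max_comm]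

/-- real value of a Boolean -/
def bv (b : Bool) : ℝ := if b = true then 1 else 0

/-- centered adjacency matrix -/
def Mx (p : Fin n × Fin n → ℝ) (ω : Fin n × Fin n → Bool) : Matrix (Fin n) (Fin n) ℝ :=
  Matrix.of fun i j => if i = j then 0 else bv (ω (edg i j)) - p (edg i j)

/-- degree plus expected degree -/
def Dg (p : Fin n × Fin n → ℝ) (ω : Fin n × Fin n → Bool) (i : Fin n) : ℝ :=
  ∑ j ∈ Finset.univ.erase i, (bv (ω (edg i j)) + p (edg i j))

lemma Mx_symm (p : Fin n × Fin n → ℝ) (ω : Fin n × Fin n → Bool) : (Mx p ω)ᵀ = Mx p ω := by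
  ext i j
  simp [Mx, eq_comm, edg_comm i j]

lemma Mx_pow_symm (p : Fin n × Fin n → ℝ) (ω : Fin n × Fin n → Bool) (k : ℕ) :
    (Mx p ω ^ k)ᵀ = Mx p ω ^ k := by
  rw [Matrix.transpose_pow, Mx_symm]

lemma Mx_diff (p : Fin n × Fin n → ℝ) (ω : Fin n × Fin n → Bool) {i j : Fin n} (hij : i ≠ j) :
    Mx p (Function.update ω (edg i j) true) - Mx p (Function.update ω (edg i j) false) =
      Matrix.single i j 1 + Matrix.single j i 1 := by
  ext a b
  simp only [Mx, Matrix.sub_apply, Matrix.of_apply, Matrix.add_apply, Matrix.single_apply]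
  by_cases hab : a = b
  · subst hab
    have h1 : ¬ (i = a ∧ j = a) := fun h => hij (h.1.trans h.2.symm)
    have h2 : ¬ (j = a ∧ i = a) := fun h => hij (h.2.trans h.1.symm)
    simp [h1, h2]
  · simp only [hab, if_false]
    by_cases he : edg a b = edg i j
    · rw [he]
      simp only [Function.update_self, bv]
      rcases (edg_eq_iff i j a b).1 he with ⟨rfl, rfl⟩ | ⟨rfl, rfl⟩
      · simp [Ne.symm hij]
      · simp [hij]
    · rw [Function.update_of_ne he, Function.update_of_ne he]
      have := mt (edg_eq_iff i j a b).2 he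
      push Not at this
      have h1 : ¬ (i = a ∧ j = b) := fun h => this.1 h.1.symm h.2.symm
      have h2 : ¬ (j = a ∧ i = b) := fun h => this.2 h.1.symm h.2.symm
      simp [h1, h2]

lemma Mx_pow_even_nonneg (p : Fin n × Fin n → ℝ) (ω : Fin n × Fin n → Bool) (q : ℕ) (i : Fin n) :
    0 ≤ (Mx p ω ^ (2 * q)) i i := by
  obtain ⟨U, x, h1, h2, h3⟩ := spec_exists _ (Mx_symm p ω)
  rw [spec_pow_diag h1 h2 h3]
  refine Finset.sum_nonneg fun k _ => mul_nonneg ?_ (sq_nonneg _)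
  rw [pow_mul]; positivity

lemma Mx_diff_pow (p : Fin n × Fin n → ℝ) (ω : Fin n × Fin n → Bool) {i j : Fin n} (hij : i ≠ j)
    (q : ℕ) :
    (Mx p (Function.update ω (edg i j) true) ^ (2 * q + 1)) i j -
      (Mx p (Function.update ω (edg i j) false) ^ (2 * q + 1)) i j ≤
    (2 * q + 1 : ℝ) / 4 * (((Mx p (Function.update ω (edg i j) true) ^ (2 * q)) i i +
      (Mx p (Function.update ω (edg i j) true) ^ (2 * q)) j j) +
      ((Mx p (Function.update ω (edg i j) false) ^ (2 * q)) i i +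
      (Mx p (Function.update ω (edg i j) false) ^ (2 * q)) j j)) := by
  have h := trace_ineq _ _ (Mx_symm p (Function.update ω (edg i j) true))
    (Mx_symm p (Function.update ω (edg i j) false)) q
  rw [Mx_diff p ω hij] at h
  set M1 := Mx p (Function.update ω (edg i j) true)
  set M0 := Mx p (Function.update ω (edg i j) false)
  have hHH : (Matrix.single i j (1:ℝ) + Matrix.single j i 1) * (Matrix.single i j 1 + Matrix.single j i 1)
      = Matrix.single i i 1 + Matrix.single j j 1 := by
    rw [Matrix.add_mul, Matrix.mul_add, Matrix.mul_add, Matrix.single_mul_single_same,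
      Matrix.single_mul_single_same, Matrix.single_mul_single_of_ne _ _ _ _ hij.symm,
      Matrix.single_mul_single_of_ne _ _ _ _ hij]
    simp
  have htr : ∀ (a b : Fin n) (Z : Matrix (Fin n) (Fin n) ℝ), (Matrix.single a b (1:ℝ) * Z).trace = Z b a := by
    intro a b Z
    rw [Matrix.trace_single_mul]; simp
  rw [hHH, Matrix.add_mul, Matrix.add_mul, Matrix.trace_add, Matrix.trace_add, htr, htr, htr, htr] at h
  have s1 : (M1 ^ (2 * q + 1)) j i = (M1 ^ (2 * q + 1)) i j := by
    rw [← Matrix.transpose_apply (M1 ^ (2 * q + 1)) i j]; rw [Mx_pow_symm]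
  have s0 : (M0 ^ (2 * q + 1)) j i = (M0 ^ (2 * q + 1)) i j := by
    rw [← Matrix.transpose_apply (M0 ^ (2 * q + 1)) i j]; rw [Mx_pow_symm]
  simp only [Matrix.sub_apply, Matrix.add_apply, s1, s0] at h
  linarith

lemma Ex_pair {p : Fin n × Fin n → ℝ} (hp : ∀ e, 0 ≤ p e ∧ p e ≤ 1) {i j : Fin n} (hij : i ≠ j)
    (q : ℕ) :
    Ex p (fun ω => Mx p ω i j * (Mx p ω ^ (2 * q + 1)) i j) ≤
    (2 * q + 1 : ℝ) / 4 * Ex p (fun ω => (bv (ω (edg i j)) + p (edg i j)) *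
      ((Mx p ω ^ (2 * q)) i i + (Mx p ω ^ (2 * q)) j j)) := by
  rw [← Ex_smul, Ex_step p (edg i j), Ex_step p (edg i j) (fun ω => (2 * q + 1 : ℝ) / 4 * _)]
  refine Ex_mono hp fun ω => ?_
  have h := Mx_diff_pow p ω hij q
  have e1 : ∀ b, Mx p (Function.update ω (edg i j) b) i j = bv b - p (edg i j) := by
    intro b; simp [Mx, hij]
  rw [e1, e1]
  simp only [Function.update_self]
  have n1 := Mx_pow_even_nonneg p (Function.update ω (edg i j) true) q i
  have n2 := Mx_pow_even_nonneg p (Function.update ω (edg i j) true) q j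
  obtain ⟨hp0, hp1⟩ := hp (edg i j)
  set a1 := (Mx p (Function.update ω (edg i j) true) ^ (2 * q + 1)) i j
  set a0 := (Mx p (Function.update ω (edg i j) false) ^ (2 * q + 1)) i j
  set g1 := (Mx p (Function.update ω (edg i j) true) ^ (2 * q)) i i +
      (Mx p (Function.update ω (edg i j) true) ^ (2 * q)) j j
  set g0 := (Mx p (Function.update ω (edg i j) false) ^ (2 * q)) i i +
      (Mx p (Function.update ω (edg i j) false) ^ (2 * q)) j j
  set r := p (edg i j)
  have t1 : bv true = 1 := rfl
  have t0 : bv false = 0 := rfl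
  rw [t1, t0]
  have hg1 : 0 ≤ g1 := add_nonneg n1 n2
  have hr : 0 ≤ r * (1 - r) := mul_nonneg hp0 (by linarith)
  have hk := mul_le_mul_of_nonneg_left h hr
  have hx : 0 ≤ (2 * q + 1 : ℝ) / 4 * (2 * r ^ 2 * g1) := by positivity
  nlinarith

lemma Mx_trace (p : Fin n × Fin n → ℝ) (ω : Fin n × Fin n → Bool) (k : ℕ) :
    (Mx p ω ^ (k + 1)).trace = ∑ i, ∑ j ∈ Finset.univ.erase i, Mx p ω i j * (Mx p ω ^ k) i j := by
  rw [pow_succ', Matrix.trace]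
  refine Finset.sum_congr rfl fun i _ => ?_
  rw [Matrix.diag_apply, Matrix.mul_apply, ← Finset.add_sum_erase Finset.univ _ (Finset.mem_univ i)]
  have : Mx p ω i i = 0 := by simp [Mx]
  rw [this, zero_mul, zero_add]
  refine Finset.sum_congr rfl fun j _ => ?_
  congr 1
  rw [← Matrix.transpose_apply (Mx p ω ^ k) i j, Mx_pow_symm]

lemma Ex_trace_step {p : Fin n × Fin n → ℝ} (hp : ∀ e, 0 ≤ p e ∧ p e ≤ 1) (q : ℕ) :
    Ex p (fun ω => (Mx p ω ^ (2 * (q + 1))).trace) ≤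
    (2 * q + 1 : ℝ) / 2 * Ex p (fun ω => ∑ i, Dg p ω i * (Mx p ω ^ (2 * q)) i i) := by
  have h0 : (fun ω => (Mx p ω ^ (2 * (q + 1))).trace) =
      fun ω => ∑ i, ∑ j ∈ Finset.univ.erase i, Mx p ω i j * (Mx p ω ^ (2 * q + 1)) i j := by
    ext ω; rw [← Mx_trace]; rfl
  rw [h0, Ex_sum]
  simp only [Ex_sum]
  have h1 : ∑ i, ∑ j ∈ Finset.univ.erase i, Ex p (fun ω => Mx p ω i j * (Mx p ω ^ (2 * q + 1)) i j) ≤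
      ∑ i : Fin n, ∑ j ∈ Finset.univ.erase i, (2 * q + 1 : ℝ) / 4 *
        Ex p (fun ω => (bv (ω (edg i j)) + p (edg i j)) *
      ((Mx p ω ^ (2 * q)) i i + (Mx p ω ^ (2 * q)) j j)) :=
    Finset.sum_le_sum fun i _ => Finset.sum_le_sum fun j hj =>
      Ex_pair hp (Finset.ne_of_mem_erase hj).symm q
  refine h1.trans (le_of_eq ?_)
  -- split
  set T : Fin n → Fin n → ℝ := fun i j => Ex p (fun ω => (bv (ω (edg i j)) + p (edg i j)) *
      (Mx p ω ^ (2 * q)) i i) with hT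
  have e1 : ∀ i j, Ex p (fun ω => (bv (ω (edg i j)) + p (edg i j)) *
      ((Mx p ω ^ (2 * q)) i i + (Mx p ω ^ (2 * q)) j j)) = T i j + T j i := by
    intro i j
    simp only [hT]
    rw [← Ex_add]
    congr 1; ext ω
    rw [edg_comm j i]; ring
  have e2 : Ex p (fun ω => ∑ i, Dg p ω i * (Mx p ω ^ (2 * q)) i i) =
      ∑ i, ∑ j ∈ Finset.univ.erase i, T i j := by
    rw [Ex_sum]
    refine Finset.sum_congr rfl fun i _ => ?_
    rw [hT, ← Ex_sum]
    congr 1; ext ω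
    rw [Dg, Finset.sum_mul]
  have e3 : ∑ i, ∑ j ∈ Finset.univ.erase i, T j i = ∑ i, ∑ j ∈ Finset.univ.erase i, T i j := by
    rw [Finset.sum_comm' (t' := Finset.univ) (s' := fun j => Finset.univ.erase j)]
    intro x y
    simp [ne_comm]
  rw [Ex_sum] at e2
  simp only [e1]
  rw [e2]
  simp only [← Finset.mul_sum, Finset.sum_add_distrib]
  rw [e3]; ring

lemma young_pow {a b c : ℝ} (ha : 0 ≤ a) (hb : 0 ≤ b) (hc : 0 < c) (q : ℕ) :
    a * b ^ q ≤ c * b ^ (q + 1) + (c⁻¹) ^ q * a ^ (q + 1) := by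
  have h1 : 0 ≤ (c⁻¹) ^ q * a ^ (q + 1) := by positivity
  have h2 : 0 ≤ c * b ^ (q + 1) := by positivity
  rcases le_total a (c * b) with h | h
  · have : a * b ^ q ≤ c * b * b ^ q := mul_le_mul_of_nonneg_right h (by positivity)
    rw [pow_succ b]; nlinarith
  · have hb' : b ≤ c⁻¹ * a := by
      rw [inv_mul_eq_div, le_div_iff₀ hc]; linarith
    have : a * b ^ q ≤ a * (c⁻¹ * a) ^ q :=
      mul_le_mul_of_nonneg_left (pow_le_pow_left₀ hb hb' q) ha
    rw [mul_pow] at this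
    rw [pow_succ a]; nlinarith

lemma Dg_nonneg {p : Fin n × Fin n → ℝ} (hp : ∀ e, 0 ≤ p e ∧ p e ≤ 1)
    (ω : Fin n × Fin n → Bool) (i : Fin n) : 0 ≤ Dg p ω i := by
  refine Finset.sum_nonneg fun j _ => add_nonneg ?_ (hp _).1
  unfold bv; split_ifs <;> norm_num

lemma Dg_young {p : Fin n × Fin n → ℝ} (hp : ∀ e, 0 ≤ p e ∧ p e ≤ 1)
    (ω : Fin n × Fin n → Bool) (q : ℕ) {c : ℝ} (hc : 0 < c) :
    ∑ i, Dg p ω i * (Mx p ω ^ (2 * q)) i i ≤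
      c * (Mx p ω ^ (2 * (q + 1))).trace + (c⁻¹) ^ q * ∑ i, Dg p ω i ^ (q + 1) := by
  obtain ⟨U, x, h1, h2, h3⟩ := spec_exists _ (Mx_symm p ω)
  rw [Matrix.trace, Finset.mul_sum, Finset.mul_sum, ← Finset.sum_add_distrib]
  refine Finset.sum_le_sum fun i _ => ?_
  rw [Matrix.diag_apply, spec_pow_diag h1 h2 h3, spec_pow_diag h1 h2 h3]
  have hr := orth_row h2 i
  calc Dg p ω i * ∑ k, x k ^ (2 * q) * U i k ^ 2
      = ∑ k, (Dg p ω i * (x k ^ 2) ^ q) * U i k ^ 2 := by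
        rw [Finset.mul_sum]; exact Finset.sum_congr rfl fun k _ => by rw [pow_mul]; ring
    _ ≤ ∑ k, (c * (x k ^ 2) ^ (q + 1) + (c⁻¹) ^ q * Dg p ω i ^ (q + 1)) * U i k ^ 2 :=
        Finset.sum_le_sum fun k _ => mul_le_mul_of_nonneg_right
          (young_pow (Dg_nonneg hp ω i) (sq_nonneg _) hc q) (sq_nonneg _)
    _ = _ := by
        simp only [add_mul, Finset.sum_add_distrib]
        rw [← Finset.mul_sum (f := fun k => U i k ^ 2), hr, mul_one, Finset.mul_sum]
        congr 1
        exact Finset.sum_congr rfl fun k _ => by rw [pow_mul]; ring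

lemma Ex_trace_le {p : Fin n × Fin n → ℝ} (hp : ∀ e, 0 ≤ p e ∧ p e ≤ 1) (q : ℕ) :
    Ex p (fun ω => (Mx p ω ^ (2 * (q + 1))).trace) ≤
      (2 * q + 1 : ℝ) ^ (q + 1) * ∑ i, Ex p (fun ω => Dg p ω i ^ (q + 1)) := by
  have h1 := Ex_trace_step hp q
  have hc : (0:ℝ) < (2 * q + 1 : ℝ)⁻¹ := by positivity
  have h2 : Ex p (fun ω => ∑ i, Dg p ω i * (Mx p ω ^ (2 * q)) i i) ≤
      (2 * q + 1 : ℝ)⁻¹ * Ex p (fun ω => (Mx p ω ^ (2 * (q + 1))).trace) +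
      (2 * q + 1 : ℝ) ^ q * ∑ i, Ex p (fun ω => Dg p ω i ^ (q + 1)) := by
    rw [← Ex_sum, ← Ex_smul, ← Ex_smul, ← Ex_add]
    refine Ex_mono hp fun ω => ?_
    have := Dg_young hp ω q hc
    rwa [inv_inv] at this
  have hk : (0:ℝ) < 2 * q + 1 := by positivity
  set T := Ex p (fun ω => (Mx p ω ^ (2 * (q + 1))).trace)
  set S := ∑ i, Ex p (fun ω => Dg p ω i ^ (q + 1))
  have h3 : T ≤ (2 * q + 1 : ℝ) / 2 * ((2 * q + 1 : ℝ)⁻¹ * T + (2 * q + 1 : ℝ) ^ q * S) :=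
    h1.trans (mul_le_mul_of_nonneg_left h2 (by positivity))
  have h4 : (2 * q + 1 : ℝ) / 2 * ((2 * q + 1 : ℝ)⁻¹ * T + (2 * q + 1 : ℝ) ^ q * S) =
      T / 2 + (2 * q + 1 : ℝ) ^ (q + 1) * S / 2 := by
    rw [pow_succ]; field_simp
  rw [h4] at h3
  linarith

lemma Ex_Dg_pow {p : Fin n × Fin n → ℝ} (hp : ∀ e, 0 ≤ p e ∧ p e ≤ 1) (i : Fin n) {m : ℝ}
    (hm : ∑ j ∈ Finset.univ.erase i, p (edg i j) ≤ m) (Q : ℕ) (hm0 : 0 < m) (hQm : (Q:ℝ) ≤ m) :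
    Ex p (fun ω => Dg p ω i ^ Q) ≤ (Real.exp 3 * m) ^ Q := by
  set l : ℝ := Q / m with hl
  have hl0 : 0 ≤ l := by positivity
  have hl1 : l ≤ 1 := by rw [hl, div_le_one hm0]; exact hQm
  have hlm : l * m = Q := by rw [hl]; field_simp
  have h1 : ∀ ω, Dg p ω i ^ Q ≤ m ^ Q * ∏ j ∈ Finset.univ.erase i,
      Real.exp (l * (bv (ω (edg i j)) + p (edg i j))) := by
    intro ω
    rw [← Real.exp_sum, ← Finset.mul_sum]
    have h2 : Dg p ω i / m ≤ Real.exp (Dg p ω i / m) := by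
      linarith [Real.add_one_le_exp (Dg p ω i / m)]
    have h3 : (Dg p ω i / m) ^ Q ≤ Real.exp (Dg p ω i / m) ^ Q :=
      pow_le_pow_left₀ (div_nonneg (Dg_nonneg hp ω i) hm0.le) h2 Q
    rw [← Real.exp_nat_mul, div_pow, div_le_iff₀ (by positivity)] at h3
    refine h3.trans (le_of_eq ?_)
    rw [mul_comm]; congr 2
    rw [hl, Dg]; ring
  have h2 := Ex_prod_le hp (fun j => edg i j)
    (fun j b => Real.exp (l * (bv b + p (edg i j)))) (fun j => Real.exp (3 * l * p (edg i j)))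
    (fun _ _ => (Real.exp_pos _).le) (Finset.univ.erase i)
    (by
      intro a ha b hb hab
      rcases (edg_eq_iff i b i a).1 hab with h | h
      · exact h.2
      · have h3 : a ≠ i := by simpa using ha
        exact absurd h.2 h3)
    (by
      intro j _
      obtain ⟨p0, p1⟩ := hp (edg i j)
      simp only [bv, if_true, Bool.false_eq_true, if_false]
      set r := p (edg i j)
      have e1 : Real.exp (l * (1 + r)) = Real.exp l * Real.exp (l * r) := by
        rw [← Real.exp_add]; ring_nf
      have e2 : Real.exp (3 * l * r) = Real.exp (2 * l * r) * Real.exp (l * r) := by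
        rw [← Real.exp_add]; ring_nf
      rw [e1, e2, zero_add]
      have e3 : Real.exp l ≤ 1 + 2 * l := by
        have := Real.abs_exp_sub_one_le (x := l) (by rw [abs_of_nonneg hl0]; exact hl1)
        rw [abs_of_nonneg hl0] at this
        linarith [le_abs_self (Real.exp l - 1)]
      have e4 := Real.add_one_le_exp (2 * l * r)
      have e5 := Real.exp_pos (l * r)
      have e6 : r * Real.exp l + (1 - r) ≤ Real.exp (2 * l * r) := by nlinarith
      nlinarith)
  have h3 : Ex p (fun ω => Dg p ω i ^ Q) ≤ m ^ Q * ∏ j ∈ Finset.univ.erase i, Real.exp (3 * l * p (edg i j)) := by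
    refine (Ex_mono hp h1).trans ?_
    rw [Ex_smul]
    exact mul_le_mul_of_nonneg_left h2 (by positivity)
  refine h3.trans ?_
  rw [← Real.exp_sum, ← Finset.mul_sum, mul_pow, mul_comm, ← Real.exp_nat_mul]
  refine mul_le_mul_of_nonneg_right (Real.exp_le_exp.2 ?_) (by positivity)
  nlinarith

lemma trace_dom (M : Matrix (Fin n) (Fin n) ℝ) (hM : Mᵀ = M) (Q : ℕ) {t : ℝ} (ht : 0 ≤ t)
    (hQ : Q ≠ 0) (h : (M ^ (2 * Q)).trace ≤ (t ^ 2) ^ Q) : OpLe M t := by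
  refine op_of_eigs M hM t fun mu v hv hMv => ?_
  obtain ⟨U, x, u1, u2, u3⟩ := spec_exists M hM
  rw [spec_trace_pow u1 u2 u3] at h
  set w := Uᵀ.mulVec v with hw
  have hvw : v = U.mulVec w := by rw [hw, Matrix.mulVec_mulVec, u2, Matrix.one_mulVec]
  have hxw : ∀ k, x k * w k = mu * w k := by
    have : (diagonal x).mulVec w = mu • w := by
      have h2 : Uᵀ.mulVec (M.mulVec v) = (diagonal x).mulVec w := by
        rw [u3, Matrix.mulVec_mulVec, hw, Matrix.mulVec_mulVec]
        congr 1
        rw [← Matrix.mul_assoc, ← Matrix.mul_assoc, u1, Matrix.one_mul]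
      rw [← h2, hMv, Matrix.mulVec_smul]
    intro k
    have := congrFun this k
    rwa [Matrix.mulVec_diagonal] at this
  have hw0 : w ≠ 0 := fun h0 => hv (by rw [hvw, h0, Matrix.mulVec_zero])
  obtain ⟨k, hk⟩ := Function.ne_iff.1 hw0
  have hk' : w k ≠ 0 := hk
  have hxk : x k = mu := mul_right_cancel₀ hk' (hxw k)
  have h1 : (mu ^ 2) ^ Q ≤ (t ^ 2) ^ Q := by
    refine le_trans ?_ h
    have := Finset.single_le_sum (f := fun k => x k ^ (2 * Q))
      (fun k _ => by rw [pow_mul]; positivity) (Finset.mem_univ k)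
    simp only [hxk] at this
    rwa [pow_mul] at this
  have h2 := le_of_pow_le_pow_left₀ hQ (by positivity) h1
  exact abs_le_of_sq_le_sq h2 ht

lemma spec_prob {p : Fin n × Fin n → ℝ} (hp : ∀ e, 0 ≤ p e ∧ p e ≤ 1) {m : ℝ}
    (hm : ∀ i : Fin n, ∑ j ∈ Finset.univ.erase i, p (edg i j) ≤ m) (Q : ℕ) (hQ : Q ≠ 0)
    (hm0 : 0 < m) (hQm : (Q:ℝ) ≤ m) :
    Pr p {ω | ¬ OpLe (Mx p ω) (Real.sqrt (2 * Real.exp 7 * Q * m))} ≤ n * Real.exp (-(4 * Q)) := by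
  obtain ⟨q, rfl⟩ := Nat.exists_eq_succ_of_ne_zero hQ
  set t : ℝ := (2 * Real.exp 7 * ((q + 1 : ℕ) : ℝ) * m) ^ (q + 1) with ht
  have ht0 : 0 < t := by positivity
  have hsub : {ω | ¬ OpLe (Mx p ω) (Real.sqrt (2 * Real.exp 7 * ((q + 1 : ℕ) : ℝ) * m))} ⊆
      {ω | t ≤ (Mx p ω ^ (2 * (q + 1))).trace} := by
    intro ω hω
    by_contra hlt
    simp only [Set.mem_setOf_eq, not_le] at hlt
    refine hω (trace_dom _ (Mx_symm p ω) (q + 1) (Real.sqrt_nonneg _) (Nat.succ_ne_zero q) ?_)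
    rw [Real.sq_sqrt (by positivity)]
    exact hlt.le
  refine (Pr_mono hp hsub).trans ?_
  have h1 := Pr_markov hp (fun ω => (Mx p ω ^ (2 * (q + 1))).trace)
    (fun ω => Finset.sum_nonneg fun i _ => Mx_pow_even_nonneg p ω (q + 1) i) t
  have h2 := Ex_trace_le hp q
  have h3 : ∑ i, Ex p (fun ω => Dg p ω i ^ (q + 1)) ≤ n * (Real.exp 3 * m) ^ (q + 1) := by
    calc _ ≤ ∑ _i : Fin n, (Real.exp 3 * m) ^ (q + 1) :=
          Finset.sum_le_sum fun i _ => Ex_Dg_pow hp i (hm i) (q + 1) hm0 hQm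
      _ = _ := by simp
  have h4 : (2 * q + 1 : ℝ) ^ (q + 1) * (n * (Real.exp 3 * m) ^ (q + 1)) ≤
      t * (n * Real.exp (-(4 * ((q + 1 : ℕ) : ℝ)))) := by
    have e1 : Real.exp (-(4 * ((q + 1 : ℕ) : ℝ))) = (Real.exp (-4)) ^ (q + 1) := by
      rw [← Real.exp_nat_mul]; congr 1; ring
    have e2 : Real.exp 7 * Real.exp (-4) = Real.exp 3 := by rw [← Real.exp_add]; norm_num
    have e3 : t * (n * Real.exp (-(4 * ((q + 1 : ℕ) : ℝ)))) =
        (2 * ((q + 1 : ℕ) : ℝ)) ^ (q + 1) * (n * (Real.exp 3 * m) ^ (q + 1)) := by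
      rw [e1, ht, ← e2]; simp only [mul_pow]; ring
    rw [e3]
    refine mul_le_mul_of_nonneg_right (pow_le_pow_left₀ (by positivity) ?_ _) (by positivity)
    push_cast; linarith
  have h5 := mul_le_mul_of_nonneg_left h3 (show (0:ℝ) ≤ (2 * q + 1 : ℝ) ^ (q + 1) by positivity)
  exact le_of_mul_le_mul_left (h1.trans (h2.trans (h5.trans h4))) ht0

end SpecBound

section RowBound
variable {n : ℕ}

lemma Mx_mulVec (p : Fin n × Fin n → ℝ) (ω : Fin n × Fin n → Bool) (y : Fin n → ℝ) (i : Fin n) :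
    (Mx p ω).mulVec y i = ∑ j ∈ Finset.univ.erase i, (bv (ω (edg i j)) - p (edg i j)) * y j := by
  rw [Matrix.mulVec, dotProduct, ← Finset.add_sum_erase Finset.univ _ (Finset.mem_univ i)]
  have : Mx p ω i i = 0 := by simp [Mx]
  rw [this, zero_mul, zero_add]
  refine Finset.sum_congr rfl fun j hj => ?_
  have : i ≠ j := (Finset.ne_of_mem_erase hj).symm
  simp [Mx, this]

lemma exp_quad {x : ℝ} (hx : |x| ≤ 1) : Real.exp x ≤ 1 + x + x ^ 2 := by
  have := Real.abs_exp_sub_one_sub_id_le hx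
  linarith [le_abs_self (Real.exp x - 1 - x)]

lemma row_mgf {p : Fin n × Fin n → ℝ} (hp : ∀ e, 0 ≤ p e ∧ p e ≤ 1) (y : Fin n → ℝ) {c : ℝ}
    (hc : c ≤ 1) (s : ℝ) (hs : ∀ j, |s * y j| ≤ c) (i : Fin n) (T : ℝ) :
    Pr p {ω | T ≤ s * (Mx p ω).mulVec y i} ≤ Real.exp (-T + n * c ^ 2) := by
  have hmk := Pr_markov hp (fun ω => Real.exp (s * (Mx p ω).mulVec y i))
    (fun ω => (Real.exp_pos _).le) (Real.exp T)
  have hset : {ω | Real.exp T ≤ Real.exp (s * (Mx p ω).mulVec y i)} =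
      {ω | T ≤ s * (Mx p ω).mulVec y i} := by
    ext ω; simp
  rw [hset] at hmk
  have hc0 : 0 ≤ c := (abs_nonneg _).trans (hs i)
  have h2 := Ex_prod_le hp (fun j => edg i j)
    (fun j b => Real.exp (s * y j * (bv b - p (edg i j)))) (fun _ => Real.exp (c ^ 2))
    (fun _ _ => (Real.exp_pos _).le) (Finset.univ.erase i)
    (by
      intro a ha b hb hab
      rcases (edg_eq_iff i b i a).1 hab with h | h
      · exact h.2
      · have h3 : a ≠ i := by simpa using ha
        exact absurd h.2 h3)
    (by
      intro j _
      obtain ⟨p0, p1⟩ := hp (edg i j)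
      simp only [bv, if_true, Bool.false_eq_true, if_false]
      set r := p (edg i j)
      set a := s * y j with ha
      have hac := hs j
      rw [← ha] at hac
      have hsq : a ^ 2 ≤ c ^ 2 := sq_le_sq' (by linarith [neg_abs_le a]) ((le_abs_self a).trans hac)
      have q1 := exp_quad (x := a * (1 - r)) (by
        rw [abs_mul, abs_of_nonneg (show 0 ≤ 1 - r by linarith)]
        nlinarith [abs_nonneg a])
      have q0 := exp_quad (x := a * (0 - r)) (by
        rw [abs_mul, zero_sub, abs_neg, abs_of_nonneg p0]
        nlinarith [abs_nonneg a])
      have q3 := Real.add_one_le_exp (c ^ 2)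
      have q4 : r * Real.exp (a * (1 - r)) + (1 - r) * Real.exp (a * (0 - r)) ≤
          r * (1 + a * (1 - r) + (a * (1 - r)) ^ 2) +
          (1 - r) * (1 + a * (0 - r) + (a * (0 - r)) ^ 2) :=
        add_le_add (mul_le_mul_of_nonneg_left q1 p0) (mul_le_mul_of_nonneg_left q0 (by linarith))
      have q5 : r * (1 + a * (1 - r) + (a * (1 - r)) ^ 2) +
          (1 - r) * (1 + a * (0 - r) + (a * (0 - r)) ^ 2) = 1 + a ^ 2 * (r * (1 - r)) := by ring
      have q6 : r * (1 - r) ≤ 1 := by nlinarith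
      have q7 : a ^ 2 * (r * (1 - r)) ≤ a ^ 2 := by nlinarith [sq_nonneg a]
      linarith)
  have h3 : Ex p (fun ω => Real.exp (s * (Mx p ω).mulVec y i)) ≤ Real.exp (n * c ^ 2) := by
    have e1 : (fun ω => Real.exp (s * (Mx p ω).mulVec y i)) = fun ω =>
        ∏ j ∈ Finset.univ.erase i, Real.exp (s * y j * (bv (ω (edg i j)) - p (edg i j))) := by
      ext ω
      rw [← Real.exp_sum, Mx_mulVec, Finset.mul_sum]
      congr 1
      exact Finset.sum_congr rfl fun j _ => by ring
    rw [e1]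
    refine h2.trans ?_
    rw [Finset.prod_const, ← Real.exp_nat_mul]
    refine Real.exp_le_exp.2 (mul_le_mul_of_nonneg_right ?_ (sq_nonneg _))
    have : (Finset.univ.erase i).card ≤ n := (Finset.card_erase_le).trans (by simp)
    exact_mod_cast this
  have h4 : Real.exp T * Pr p {ω | T ≤ s * (Mx p ω).mulVec y i} ≤
      Real.exp T * Real.exp (-T + n * c ^ 2) := by
    rw [← Real.exp_add]
    refine (hmk.trans h3).trans (le_of_eq ?_)
    congr 1; ring
  exact le_of_mul_le_mul_left h4 (Real.exp_pos _)

lemma row_prob {p : Fin n × Fin n → ℝ} (hp : ∀ e, 0 ≤ p e ∧ p e ≤ 1) (y : Fin n → ℝ) {B L : ℝ}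
    (hB : 0 < B) (hy : ∀ j, |y j| ≤ B) (hL : 0 < L) (hn : 0 < n) (hLn : L ≤ n) (i : Fin n) :
    Pr p {ω | 5 * B * Real.sqrt (n * L) < |(Mx p ω).mulVec y i|} ≤ 2 * Real.exp (-(4 * L)) := by
  have hn' : (0:ℝ) < n := by exact_mod_cast hn
  set c : ℝ := Real.sqrt (L / n) with hc
  have hc1 : c ≤ 1 := by
    rw [hc, Real.sqrt_le_iff]
    exact ⟨zero_le_one, by rw [one_pow, div_le_one hn']; exact hLn⟩
  have hcpos : 0 < c := Real.sqrt_pos.2 (by positivity)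
  have hcc : c ^ 2 = L / n := Real.sq_sqrt (by positivity)
  have hprod : c * Real.sqrt (n * L) = L := by
    rw [hc, ← Real.sqrt_mul (by positivity), show L / n * (n * L) = L ^ 2 by field_simp,
      Real.sqrt_sq hL.le]
  have hs : ∀ j, |c / B * y j| ≤ c := by
    intro j
    rw [abs_mul, abs_of_nonneg (by positivity)]
    calc c / B * |y j| ≤ c / B * B := mul_le_mul_of_nonneg_left (hy j) (by positivity)
      _ = c := by field_simp
  have h1 := row_mgf hp y hc1 (c / B) hs i (5 * L)
  have h2 := row_mgf hp y hc1 (-(c / B)) (fun j => by rw [neg_mul, abs_neg]; exact hs j) i (5 * L)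
  have he : -(5 * L) + n * c ^ 2 = -(4 * L) := by rw [hcc]; field_simp; ring
  rw [he] at h1 h2
  have hsub : {ω | 5 * B * Real.sqrt (n * L) < |(Mx p ω).mulVec y i|} ⊆
      {ω | 5 * L ≤ c / B * (Mx p ω).mulVec y i} ∪ {ω | 5 * L ≤ -(c / B) * (Mx p ω).mulVec y i} := by
    intro ω hω
    have h5 : 5 * L = c / B * (5 * B * Real.sqrt (n * L)) := by
      have : c / B * (5 * B * Real.sqrt (n * L)) = 5 * (c * Real.sqrt (n * L)) := by field_simp
      rw [this, hprod]
    have hω' : 5 * B * Real.sqrt (n * L) < |(Mx p ω).mulVec y i| := hω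
    rcases lt_abs.1 hω' with h | h
    · left
      show 5 * L ≤ c / B * (Mx p ω).mulVec y i
      rw [h5]; exact mul_le_mul_of_nonneg_left h.le (by positivity)
    · right
      show 5 * L ≤ -(c / B) * (Mx p ω).mulVec y i
      rw [h5, neg_mul, ← mul_neg]; exact mul_le_mul_of_nonneg_left h.le (by positivity)
  have := (Pr_mono hp hsub).trans (Pr_union_le hp _ _)
  linarith

end RowBound

section Cov
open ProbabilityTheory
variable {d : ℕ}

lemma ae_msupport (F : Measure (Fin d → ℝ)) : ∀ᵐ x ∂F, x ∈ msupport F := by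
  have h := Measure.support_mem_ae (μ := F)
  filter_upwards [h] with x hx
  rw [Measure.support_eq_forall_isOpen] at hx
  exact fun U hU hxU => hx U hxU hU

lemma pi_ae {n : ℕ} (F : Measure (Fin d → ℝ)) [IsProbabilityMeasure F] {P : (Fin d → ℝ) → Prop}
    (h : ∀ᵐ x ∂F, P x) : ∀ᵐ X ∂(Measure.pi fun _ : Fin n => F), ∀ i, P (X i) := by
  rw [ae_all_iff]
  intro i
  exact (Measure.quasiMeasurePreserving_eval (fun _ : Fin n => F) i).ae h

lemma hoeff (F : Measure (Fin d → ℝ)) [IsProbabilityMeasure F] (f : (Fin d → ℝ) → ℝ)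
    (hf : Measurable f) {b : ℝ} (hb : 0 < b) (hfb : ∀ᵐ x ∂F, |f x| ≤ b) (n : ℕ) {ε : ℝ}
    (hε : 0 ≤ ε) :
    (Measure.pi fun _ : Fin n => F) {X | ε * n ≤ ∑ i, (f (X i) - ∫ x, f x ∂F)} ≤
      ENNReal.ofReal (Real.exp (-(ε ^ 2 / (2 * b ^ 2) * n))) := by
  set P := (Measure.pi fun _ : Fin n => F) with hP
  have hind : iIndepFun (fun (i : Fin n) (X : Fin n → Fin d → ℝ) => f (X i) - ∫ x, f x ∂F) P :=
    iIndepFun_pi (X := fun _ x => f x - ∫ x, f x ∂F)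
      (fun _ => (hf.sub_const _).aemeasurable)
  have hsub : ∀ i ∈ (Finset.univ : Finset (Fin n)), HasSubgaussianMGF
      (fun (X : Fin n → Fin d → ℝ) => f (X i) - ∫ x, f x ∂F) ((‖b - (-b)‖₊ / 2) ^ 2) P := by
    intro i _
    have h1 := hasSubgaussianMGF_of_mem_Icc (μ := P) (X := fun X : Fin n → Fin d → ℝ => f (X i))
      (a := -b) (b := b) (hf.comp (measurable_pi_apply i)).aemeasurable (by
        filter_upwards [pi_ae (n := n) F hfb] with X hX
        exact abs_le.1 (hX i))
    have h2 : ∫ X, f (X i) ∂P = ∫ x, f x ∂F := by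
      have := (measurePreserving_eval (fun _ : Fin n => F) i).map_eq
      conv_rhs => rw [← this]
      rw [integral_map (measurable_pi_apply i).aemeasurable hf.aestronglyMeasurable]
    rwa [h2] at h1
  have h := HasSubgaussianMGF.measure_sum_ge_le_of_iIndepFun hind hsub
    (ε := ε * n) (by positivity)
  rw [← ENNReal.ofReal_toReal (measure_ne_top P _)]
  refine ENNReal.ofReal_le_ofReal (h.trans (Real.exp_le_exp.2 (le_of_eq ?_)))
  have e : ((‖b - (-b)‖₊ / 2 : ℝ≥0) : ℝ) = b := by
    push_cast
    rw [Real.norm_eq_abs, sub_neg_eq_add, abs_of_pos (by linarith)]; ring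
  simp only [Finset.sum_const, Finset.card_univ, Fintype.card_fin, nsmul_eq_mul]
  push_cast at e ⊢
  rw [e]
  rcases Nat.eq_zero_or_pos n with h0 | h0
  · subst h0; simp
  · have : (0:ℝ) < n := by exact_mod_cast h0
    field_simp

lemma hoeff_abs (F : Measure (Fin d → ℝ)) [IsProbabilityMeasure F] (f : (Fin d → ℝ) → ℝ)
    (hf : Measurable f) {b : ℝ} (hb : 0 < b) (hfb : ∀ᵐ x ∂F, |f x| ≤ b) (n : ℕ) {ε : ℝ}
    (hε : 0 ≤ ε) :
    (Measure.pi fun _ : Fin n => F) {X | ε * n < |∑ i, f (X i) - n * ∫ x, f x ∂F|} ≤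
      2 * ENNReal.ofReal (Real.exp (-(ε ^ 2 / (2 * b ^ 2) * n))) := by
  have h1 := hoeff F f hf hb hfb n hε
  have h2 := hoeff F (fun x => -f x) hf.neg hb (by simpa using hfb) n hε
  refine (measure_mono (t := {X | ε * n ≤ ∑ i, (f (X i) - ∫ x, f x ∂F)} ∪
    {X | ε * n ≤ ∑ i, (-f (X i) - ∫ x, -f x ∂F)}) ?_).trans
    ((measure_union_le _ _).trans ((add_le_add h1 h2).trans (le_of_eq (two_mul _).symm)))
  intro X hX
  have hX' : ε * n < |∑ i, f (X i) - n * ∫ x, f x ∂F| := hX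
  have e1 : ∑ i, (f (X i) - ∫ x, f x ∂F) = ∑ i, f (X i) - n * ∫ x, f x ∂F := by
    rw [Finset.sum_sub_distrib]; simp
  have e2 : ∑ i, (-f (X i) - ∫ x, -f x ∂F) = -(∑ i, f (X i) - n * ∫ x, f x ∂F) := by
    rw [Finset.sum_sub_distrib, integral_neg]; simp; ring
  rcases lt_abs.1 hX' with h | h
  · left
    show ε * n ≤ ∑ i, (f (X i) - ∫ x, f x ∂F)
    rw [e1]; exact h.le
  · right
    show ε * n ≤ ∑ i, (-f (X i) - ∫ x, -f x ∂F)
    rw [e2]; exact h.le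

lemma coord_le {B : ℝ} (hB : 0 ≤ B) {x : Fin d → ℝ} (hx : dotd x x ≤ B ^ 2) (k : Fin d) : |x k| ≤ B := by
  refine abs_le_of_sq_le_sq ?_ hB
  refine le_trans ?_ hx
  have := Finset.single_le_sum (f := fun k => x k * x k) (fun k _ => mul_self_nonneg _)
    (Finset.mem_univ k)
  rw [pow_two]; exact this

lemma second_lower (F : Measure (Fin d → ℝ)) [IsProbabilityMeasure F] {B : ℝ} (hB : 0 < B)
    (hF : ∀ᵐ x ∂F, dotd x x ≤ B ^ 2) (hrank : (secondMoment F).det ≠ 0) :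
    ∃ δ : ℝ, 0 < δ ∧ ∀ v : Fin d → ℝ, δ * (v ⬝ᵥ v) ≤ v ⬝ᵥ (secondMoment F).mulVec v := by
  have hinteg : ∀ k l : Fin d, Integrable (fun x : Fin d → ℝ => x k * x l) F := by
    intro k l
    refine Integrable.of_mem_Icc (-(B * B)) (B * B)
      ((measurable_pi_apply k).mul (measurable_pi_apply l)).aemeasurable ?_
    filter_upwards [hF] with x hx
    refine abs_le.1 ?_
    rw [abs_mul]
    exact mul_le_mul (coord_le hB.le hx k) (coord_le hB.le hx l) (abs_nonneg _) hB.le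
  have hsym : (secondMoment F)ᵀ = secondMoment F := by
    ext k l
    simp only [secondMoment, Matrix.transpose_apply, Matrix.of_apply]
    congr 1; ext x; ring
  have hquad : ∀ v : Fin d → ℝ, 0 ≤ v ⬝ᵥ (secondMoment F).mulVec v := by
    intro v
    have : v ⬝ᵥ (secondMoment F).mulVec v = ∫ x, (v ⬝ᵥ x) ^ 2 ∂F := by
      have e : ∀ x : Fin d → ℝ, (v ⬝ᵥ x) ^ 2 = ∑ k, ∑ l, v k * v l * (x k * x l) := by
        intro x
        rw [pow_two, dotProduct, Finset.sum_mul_sum]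
        exact Finset.sum_congr rfl fun k _ => Finset.sum_congr rfl fun l _ => by ring
      simp only [e]
      rw [integral_finset_sum _ (fun k _ => integrable_finset_sum _ fun l _ => (hinteg k l).const_mul _)]
      simp only [dotProduct, Matrix.mulVec, Finset.mul_sum]
      refine Finset.sum_congr rfl fun k _ => ?_
      rw [integral_finset_sum _ (fun l _ => (hinteg k l).const_mul _)]
      refine Finset.sum_congr rfl fun l _ => ?_
      rw [integral_const_mul]
      simp only [secondMoment, Matrix.of_apply]; ring
    rw [this]
    exact integral_nonneg fun x => sq_nonneg _
  obtain ⟨U, x, u1, u2, u3⟩ := spec_exists _ hsym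
  have hconj : ∀ v : Fin d → ℝ, v ⬝ᵥ (secondMoment F).mulVec v =
      Uᵀ.mulVec v ⬝ᵥ (diagonal x).mulVec (Uᵀ.mulVec v) := by
    intro v
    rw [u3, Matrix.mul_assoc, ← Matrix.mulVec_mulVec, ← Matrix.mulVec_mulVec,
      Matrix.dotProduct_mulVec v, ← Matrix.mulVec_transpose]
  have hx0 : ∀ k, 0 ≤ x k := by
    intro k
    have h1 := hquad (U.mulVec (Pi.single k 1))
    rw [hconj, Matrix.mulVec_mulVec, u1, Matrix.one_mulVec] at h1
    simpa using h1
  have hxne : ∀ k, x k ≠ 0 := by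
    have : (secondMoment F).det = ∏ k, x k := by
      rw [u3, Matrix.det_mul, Matrix.det_mul, Matrix.det_diagonal, mul_right_comm, ← Matrix.det_mul, u2]
      simp
    rw [this] at hrank
    intro k hk
    exact hrank (Finset.prod_eq_zero (Finset.mem_univ k) hk)
  have hxpos : ∀ k, 0 < x k := fun k => lt_of_le_of_ne (hx0 k) (hxne k).symm
  refine ⟨(1 + ∑ k, (x k)⁻¹)⁻¹, ?_, ?_⟩
  · have : 0 ≤ ∑ k, (x k)⁻¹ := Finset.sum_nonneg fun k _ => (inv_pos.2 (hxpos k)).le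
    positivity
  · intro v
    rw [hconj]
    have hvv : v ⬝ᵥ v = Uᵀ.mulVec v ⬝ᵥ Uᵀ.mulVec v := by
      rw [Matrix.dotProduct_mulVec, ← Matrix.mulVec_transpose, Matrix.transpose_transpose,
        Matrix.mulVec_mulVec, u2, Matrix.one_mulVec]
    rw [hvv]
    refine diag_quad_lower x _ (fun k => ?_) _
    rw [inv_le_comm₀ (by
      have : 0 ≤ ∑ k, (x k)⁻¹ := Finset.sum_nonneg fun k _ => (inv_pos.2 (hxpos k)).le
      positivity) (hxpos k)]
    have := Finset.single_le_sum (f := fun k => (x k)⁻¹) (fun k _ => (inv_pos.2 (hxpos k)).le)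
      (Finset.mem_univ k)
    linarith

/-- lower bound for the empirical Gram matrix -/
lemma cov_prob (F : Measure (Fin d → ℝ)) [IsProbabilityMeasure F] {B : ℝ} (hB : 0 < B)
    (hF : ∀ᵐ x ∂F, dotd x x ≤ B ^ 2) (hrank : (secondMoment F).det ≠ 0) :
    ∃ κ : ℝ, 0 < κ ∧ ∃ c : ℝ, 0 < c ∧ ∀ n : ℕ,
      (Measure.pi fun _ : Fin n => F) {X | ¬ ∀ v : Fin d → ℝ,
        κ * n * (v ⬝ᵥ v) ≤ (Matrix.of X).mulVec v ⬝ᵥ (Matrix.of X).mulVec v} ≤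
      ENNReal.ofReal (2 * d ^ 2 * Real.exp (-(c * n))) := by
  obtain ⟨δ, hδ, hlow⟩ := second_lower F hB hF hrank
  set ε : ℝ := δ / (2 * (d + 1)) with hε
  have hε0 : 0 < ε := by positivity
  refine ⟨δ / 2, by positivity, ε ^ 2 / (2 * (B * B) ^ 2), by positivity, fun n => ?_⟩
  have hkl : ∀ k l : Fin d, (Measure.pi fun _ : Fin n => F)
      {X | ε * n < |∑ i, X i k * X i l - n * secondMoment F k l|} ≤
      2 * ENNReal.ofReal (Real.exp (-(ε ^ 2 / (2 * (B * B) ^ 2) * n))) := by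
    intro k l
    refine hoeff_abs F (fun x => x k * x l)
      ((measurable_pi_apply k).mul (measurable_pi_apply l)) (by positivity) ?_ n hε0.le
    filter_upwards [hF] with x hx
    rw [abs_mul]
    exact mul_le_mul (coord_le hB.le hx k) (coord_le hB.le hx l) (abs_nonneg _) hB.le
  refine (measure_mono (t := ⋃ k : Fin d, ⋃ l : Fin d,
      {X | ε * n < |∑ i, X i k * X i l - n * secondMoment F k l|}) ?_).trans ?_
  · intro X hX
    by_contra hcon
    simp only [Set.mem_iUnion, not_exists, Set.mem_setOf_eq, not_lt] at hcon
    apply hX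
    intro v
    have e1 : (Matrix.of X).mulVec v ⬝ᵥ (Matrix.of X).mulVec v =
        ∑ k, ∑ l, v k * v l * ∑ i, X i k * X i l := by
      simp only [dotProduct, Matrix.mulVec, Matrix.of_apply, Finset.sum_mul_sum]
      simp only [Finset.mul_sum]
      rw [Finset.sum_comm]
      refine Finset.sum_congr rfl fun k _ => ?_
      rw [Finset.sum_comm]
      exact Finset.sum_congr rfl fun l _ => Finset.sum_congr rfl fun i _ => by ring
    have e2 : n * (v ⬝ᵥ (secondMoment F).mulVec v) = ∑ k, ∑ l, v k * v l * (n * secondMoment F k l) := by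
      simp only [dotProduct, Matrix.mulVec, Finset.mul_sum]
      exact Finset.sum_congr rfl fun k _ => Finset.sum_congr rfl fun l _ => by ring
    have e3 : n * (v ⬝ᵥ (secondMoment F).mulVec v) - (Matrix.of X).mulVec v ⬝ᵥ (Matrix.of X).mulVec v ≤
        ε * n * (∑ k, |v k|) ^ 2 := by
      rw [e1, e2, ← Finset.sum_sub_distrib, pow_two, Finset.sum_mul_sum, Finset.mul_sum]
      refine Finset.sum_le_sum fun k _ => ?_
      rw [← Finset.sum_sub_distrib, Finset.mul_sum]
      refine Finset.sum_le_sum fun l _ => ?_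
      calc v k * v l * (n * secondMoment F k l) - v k * v l * ∑ i, X i k * X i l
          = -(v k * v l * (∑ i, X i k * X i l - n * secondMoment F k l)) := by ring
        _ ≤ |v k * v l * (∑ i, X i k * X i l - n * secondMoment F k l)| := neg_le_abs _
        _ = |v k| * |v l| * |∑ i, X i k * X i l - n * secondMoment F k l| := by
            rw [abs_mul, abs_mul]
        _ ≤ |v k| * |v l| * (ε * n) := mul_le_mul_of_nonneg_left (hcon k l) (by positivity)
        _ = _ := by ring
    have e4 : (∑ k, |v k|) ^ 2 ≤ d * (v ⬝ᵥ v) := by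
      have := sq_sum_le_card_mul_sum_sq (s := (Finset.univ : Finset (Fin d))) (f := fun k => |v k|)
      simpa [dotProduct, pow_two] using this
    have e5 := mul_le_mul_of_nonneg_left (hlow v) (show (0:ℝ) ≤ n by positivity)
    have e6 : ε * n * (∑ k, |v k|) ^ 2 ≤ ε * n * (d * (v ⬝ᵥ v)) :=
      mul_le_mul_of_nonneg_left e4 (by positivity)
    have e7 : ε * d ≤ δ / 2 := by
      rw [hε, div_mul_eq_mul_div, div_le_div_iff₀ (by positivity) (by positivity)]
      nlinarith
    have e8 : ε * d * (n * (v ⬝ᵥ v)) ≤ δ / 2 * (n * (v ⬝ᵥ v)) :=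
      mul_le_mul_of_nonneg_right e7 (mul_nonneg (by positivity) (dot_self_nonneg v))
    nlinarith
  · refine (measure_iUnion_fintype_le _ _).trans ?_
    calc _ ≤ ∑ _k : Fin d, ∑ _l : Fin d, 2 * ENNReal.ofReal (Real.exp (-(ε ^ 2 / (2 * (B * B) ^ 2) * n))) :=
          Finset.sum_le_sum fun k _ => (measure_iUnion_fintype_le _ _).trans
            (Finset.sum_le_sum fun l _ => hkl k l)
      _ = _ := by
          rw [ENNReal.ofReal_mul (by positivity)]
          simp only [Finset.sum_const, Finset.card_univ, Fintype.card_fin, nsmul_eq_mul]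
          rw [ENNReal.ofReal_mul (by norm_num), ENNReal.ofReal_pow (by positivity), ENNReal.ofReal_natCast]
          simp only [ENNReal.ofReal_ofNat]
          ring

end Cov

section GoodDet

lemma dotd_comm {d : ℕ} (x y : Fin d → ℝ) : dotd x y = dotd y x := by
  simp [dotd, mul_comm]

lemma dotd_self {d : ℕ} (x : Fin d → ℝ) : dotd x x = euclNorm x ^ 2 := by
  rw [eucl_sq]; rfl

lemma OpLe.mono {n : ℕ} {E : Matrix (Fin n) (Fin n) ℝ} {s t : ℝ} (h : OpLe E s) (hs : 0 ≤ s)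
    (hst : s ≤ t) : OpLe E t := fun v => (h v).trans
  (mul_le_mul_of_nonneg_right (pow_le_pow_left₀ hs hst 2) (dot_self_nonneg v))

lemma OpLe.eucl {n : ℕ} {E : Matrix (Fin n) (Fin n) ℝ} {t : ℝ} (h : OpLe E t) (ht : 0 ≤ t)
    (v : Fin n → ℝ) : euclNorm (E.mulVec v) ≤ t * euclNorm v := by
  refine abs_le_of_sq_le_sq' ?_ (mul_nonneg ht (eucl_nonneg _)) |>.2
  rw [mul_pow, eucl_sq, eucl_sq]; exact h v

lemma OpLe.sub_diag {n : ℕ} {M : Matrix (Fin n) (Fin n) ℝ} {s t : ℝ} (h : OpLe M s) (hs : 0 ≤ s)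
    (ht : 0 ≤ t) (D : Fin n → ℝ) (hD : ∀ i, |D i| ≤ t) : OpLe (M - diagonal D) (s + t) := by
  intro v
  have h1 : OpLe (diagonal D) t := by
    intro v
    rw [dotProduct, dotProduct, Finset.mul_sum]
    refine Finset.sum_le_sum fun i _ => ?_
    rw [Matrix.mulVec_diagonal]
    have : D i ^ 2 ≤ t ^ 2 := sq_le_sq' (by linarith [neg_abs_le (D i), hD i]) ((le_abs_self _).trans (hD i))
    nlinarith [mul_self_nonneg (v i)]
  have h2 : euclNorm ((M - diagonal D).mulVec v) ≤ (s + t) * euclNorm v := by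
    rw [Matrix.sub_mulVec, sub_eq_add_neg]
    refine (eucl_add_le _ _).trans ?_
    rw [eucl_neg, add_mul]
    exact add_le_add (h.eucl hs v) (h1.eucl ht v)
  rw [← eucl_sq, ← eucl_sq, ← mul_pow]
  exact pow_le_pow_left₀ (eucl_nonneg _) h2 2

lemma eucl_le_sum {d : ℕ} (x : Fin d → ℝ) (r : ℝ) (hr : 0 ≤ r) (h : ∀ k, |x k| ≤ r) :
    euclNorm x ≤ d * r := by
  refine abs_le_of_sq_le_sq' ?_ (by positivity) |>.2
  rw [eucl_sq, dotProduct]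
  have h1 : ∑ k, x k * x k ≤ ∑ _k : Fin d, r ^ 2 := Finset.sum_le_sum fun k _ => by
    have := h k
    rw [← pow_two]
    exact sq_le_sq' (by linarith [neg_abs_le (x k)]) ((le_abs_self _).trans this)
  refine h1.trans ?_
  simp only [Finset.sum_const, Finset.card_univ, Fintype.card_fin, nsmul_eq_mul, mul_pow]
  refine mul_le_mul_of_nonneg_right ?_ (sq_nonneg r)
  have : d ≤ d ^ 2 := Nat.le_self_pow two_ne_zero d
  exact_mod_cast this

/-- edge probabilities -/
def pX {n d : ℕ} (ρ : ℝ) (X : Fin n → Fin d → ℝ) (e : Fin n × Fin n) : ℝ :=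
  ρ * dotd (X e.1) (X e.2)

lemma pX_edg {n d : ℕ} (ρ : ℝ) (X : Fin n → Fin d → ℝ) (i j : Fin n) :
    pX ρ X (edg i j) = ρ * dotd (X i) (X j) := by
  unfold pX edg
  rcases le_total i j with h | h
  · simp [h]
  · simp [h, dotd_comm]

lemma adj_decomp {n d : ℕ} {ρ : ℝ} (hρ : 0 ≤ ρ) (X : Fin n → Fin d → ℝ) (u : Fin n × Fin n → ℝ) :
    Matrix.of (adjOf ρ X u) - Matrix.of (fun i j => Real.sqrt ρ * X i j) *
      (Matrix.of (fun i j => Real.sqrt ρ * X i j))ᵀ =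
    Mx (pX ρ X) (fun e => decide (u e < pX ρ X e)) - diagonal (fun i => ρ * dotd (X i) (X i)) := by
  have hYY : ∀ i j, (Matrix.of (fun i j => Real.sqrt ρ * X i j) *
      (Matrix.of (fun i j => Real.sqrt ρ * X i j))ᵀ) i j = ρ * dotd (X i) (X j) := by
    intro i j
    rw [Matrix.mul_apply, dotd, Finset.mul_sum]
    refine Finset.sum_congr rfl fun k _ => ?_
    simp only [Matrix.of_apply, Matrix.transpose_apply]
    have := Real.mul_self_sqrt hρ
    linear_combination X i k * X j k * this
  ext i j
  rw [Matrix.sub_apply, hYY, Matrix.sub_apply, Matrix.diagonal_apply]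
  simp only [Matrix.of_apply, Mx, adjOf]
  by_cases hij : i = j
  · subst hij; simp
  · have : (min i j, max i j) = edg i j := rfl
    simp only [hij, if_false, pX_edg, bv, decide_eq_true_eq, this, sub_zero]

lemma adj_symm {n d : ℕ} (ρ : ℝ) (X : Fin n → Fin d → ℝ) (u : Fin n × Fin n → ℝ) :
    (Matrix.of (adjOf ρ X u))ᵀ = Matrix.of (adjOf ρ X u) := by
  ext i j
  simp only [Matrix.transpose_apply, Matrix.of_apply, adjOf]
  rw [dotd_comm (X j) (X i), min_comm j i, max_comm j i]
  simp [eq_comm]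

/-- intermediate constant -/
def cc3 (d : ℕ) (B κ c : ℝ) : ℝ :=
  (d : ℝ) ^ 2 * c / Real.sqrt (κ / 2) + (1 + d) * c * B / (κ / 2)

/-- final constant -/
def ccF (d : ℕ) (B κ c : ℝ) : ℝ :=
  (B * (cc3 d B κ c * (B + cc3 d B κ c)) + d * (5 * B + B ^ 3) + c * cc3 d B κ c) / (κ / 2)

set_option maxHeartbeats 2000000 in
open scoped Matrix.Norms.Frobenius in
lemma good_det {n d : ℕ} (hdn : d ≤ n) {ρ B κ c1 a b : ℝ} (X : Fin n → Fin d → ℝ)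
    (u : Fin n × Fin n → ℝ) (hρ0 : 0 < ρ) (hρ1 : ρ ≤ 1) (hB : 1 ≤ B) (hκ : 0 < κ) (hc1 : 0 ≤ c1)
    (hX : ∀ i, dotd (X i) (X i) ≤ B ^ 2) (ha : a ^ 2 = ρ * n) (hb : 1 ≤ b)
    (hba : b ≤ a) (hgap : 4 * ((c1 + B ^ 2) * b) ≤ κ * a)
    (hop : OpLe (Mx (pX ρ X) (fun e => decide (u e < pX ρ X e))) (c1 * a * b))
    (hrow : ∀ i k, Real.sqrt ρ * |(Mx (pX ρ X) (fun e => decide (u e < pX ρ X e))).mulVec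
      (fun j => X j k) i| ≤ 5 * B * a * b)
    (hgram : ∀ v : Fin d → ℝ,
        κ * n * (v ⬝ᵥ v) ≤ (Matrix.of X).mulVec v ⬝ᵥ (Matrix.of X).mulVec v) :
    ∃ Q : Matrix (Fin d) (Fin d) ℝ, Qᵀ * Q = 1 ∧ ∀ i,
      euclNorm ((Matrix.of (ase d (adjOf ρ X u)) * Q -
        Matrix.of (fun i j => Real.sqrt ρ * X i j)) i) ≤ ccF d B κ (c1 + B ^ 2) * (b ^ 2 / a) := by
  have ha1 : 1 ≤ a := hb.trans hba
  have ha0 : 0 < a := by linarith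
  have hb0 : 0 < b := by linarith
  have hB0 : 0 < B := by linarith
  have hsρ1 : Real.sqrt ρ ≤ 1 := by rw [Real.sqrt_le_iff]; simpa using hρ1
  have hsρ0 : 0 ≤ Real.sqrt ρ := Real.sqrt_nonneg _
  have hsρ : Real.sqrt ρ ^ 2 = ρ := Real.sq_sqrt hρ0.le
  obtain ⟨U, lam, htop, hase⟩ := ase_spec (d := d) (adjOf ρ X u) (adj_symm ρ X u) hdn
  set Y : Matrix (Fin n) (Fin d) ℝ := Matrix.of (fun i j => Real.sqrt ρ * X i j) with hY
  set M := Mx (pX ρ X) (fun e => decide (u e < pX ρ X e)) with hM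
  set c := c1 + B ^ 2 with hc
  have hc0 : 0 < c := by positivity
  have hEdec : Matrix.of (adjOf ρ X u) - Y * Yᵀ = M - diagonal (fun i => ρ * dotd (X i) (X i)) :=
    adj_decomp hρ0.le X u
  have hdot0 : ∀ i, 0 ≤ dotd (X i) (X i) := fun i => by rw [dotd_self]; positivity
  have hE : OpLe (Matrix.of (adjOf ρ X u) - Y * Yᵀ) (c * a * b) := by
    rw [hEdec]
    refine (hop.sub_diag (by positivity) (t := B ^ 2) (by positivity) _ (fun i => ?_)).mono
      (by positivity) ?_
    · rw [abs_of_nonneg (mul_nonneg hρ0.le (hdot0 i))]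
      nlinarith [hX i, hdot0 i]
    · have : 1 ≤ a * b := by nlinarith
      have : B ^ 2 ≤ B ^ 2 * (a * b) := le_mul_of_one_le_right (by positivity) this
      rw [hc]; nlinarith
  have hYn : ∀ i, euclNorm (Y i) = Real.sqrt ρ * euclNorm (X i) := by
    intro i
    refine (pow_left_inj₀ (eucl_nonneg _) (mul_nonneg hsρ0 (eucl_nonneg _)) two_ne_zero).1 ?_
    rw [mul_pow, eucl_sq, eucl_sq, hsρ, dotProduct, dotProduct, Finset.mul_sum]
    refine Finset.sum_congr rfl fun k _ => ?_
    simp only [hY, Matrix.of_apply]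
    linear_combination X i k * X i k * hsρ
  have hXn : ∀ i, euclNorm (X i) ≤ B := fun i => by
    refine abs_le_of_sq_le_sq' ?_ hB0.le |>.2
    rw [← dotd_self]; exact hX i
  have hYi : ∀ i, euclNorm (Y i) ≤ Real.sqrt ρ * B := fun i => by
    rw [hYn]; exact mul_le_mul_of_nonneg_left (hXn i) hsρ0
  have hYF : ‖Y‖ ≤ B * a := by
    refine abs_le_of_sq_le_sq' ?_ (by positivity) |>.2
    rw [fro_rows]
    calc ∑ i, euclNorm (Y i) ^ 2 ≤ ∑ _i : Fin n, ρ * B ^ 2 := Finset.sum_le_sum fun i _ => by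
          rw [← hsρ, ← mul_pow]; exact pow_le_pow_left₀ (eucl_nonneg _) (hYi i) 2
      _ = (B * a) ^ 2 := by simp [mul_pow, ha]; ring
  have hg : ∀ w : Fin d → ℝ, κ * a ^ 2 * (w ⬝ᵥ w) ≤ Y.mulVec w ⬝ᵥ Y.mulVec w := by
    intro w
    have e : Y.mulVec w = Real.sqrt ρ • (Matrix.of X).mulVec w := by
      rw [← Matrix.smul_mulVec]; rfl
    rw [e, smul_dotProduct, dotProduct_smul, smul_eq_mul, smul_eq_mul, ← mul_assoc, ← pow_two, hsρ, ha]
    nlinarith [mul_le_mul_of_nonneg_left (hgram w) hρ0.le]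
  have hgt : 4 * (c * a * b) ≤ κ * a ^ 2 := by nlinarith
  obtain ⟨Q, hQ, δ, hδ0, hδ, hmain⟩ := det_main htop (adj_symm ρ X u) Y (τ := c * a * b)
    (g := κ * a ^ 2) (by positivity) hE hg (by positivity) hgt
  refine ⟨Q, hQ, fun i => ?_⟩
  rw [hase]
  have hi := hmain i
  set e := euclNorm ((U * diagonal (fun j => Real.sqrt |lam j|) * Q - Y) i) with he
  set c3 := cc3 d B κ c with hc3
  have hc30 : 0 ≤ c3 := by rw [hc3, cc3]; positivity
  have hδ3 : δ ≤ c3 * b := by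
    refine hδ.trans ?_
    have h1 : Real.sqrt (κ * a ^ 2 / 2) = Real.sqrt (κ / 2) * a := by
      rw [show κ * a ^ 2 / 2 = κ / 2 * a ^ 2 by ring, Real.sqrt_mul (by positivity), Real.sqrt_sq ha0.le]
    have hs2 : 0 < Real.sqrt (κ / 2) := Real.sqrt_pos.2 (by positivity)
    rw [h1, hc3, cc3, add_mul ((d:ℝ) ^ 2 * c / Real.sqrt (κ / 2))]
    have hE1 : (d:ℝ) ^ 2 * (c * a * b) / (Real.sqrt (κ / 2) * a) =
        (d:ℝ) ^ 2 * c / Real.sqrt (κ / 2) * b := by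
      rw [div_mul_eq_mul_div, div_eq_div_iff (by positivity) (by positivity)]
      ring
    refine add_le_add hE1.le ?_
    calc (1 + d) * (c * a * b) * ‖Y‖ / (κ * a ^ 2 / 2)
        ≤ (1 + d) * (c * a * b) * (B * a) / (κ * a ^ 2 / 2) := by gcongr
      _ = _ := by field_simp
  have hEY : euclNorm (((Matrix.of (adjOf ρ X u) - Y * Yᵀ) * Y) i) ≤ d * ((5 * B + B ^ 3) * (a * b)) := by
    refine eucl_le_sum _ _ (by positivity) fun k => ?_
    have e1 : ((Matrix.of (adjOf ρ X u) - Y * Yᵀ) * Y) i k =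
        Real.sqrt ρ * M.mulVec (fun j => X j k) i - ρ * dotd (X i) (X i) * (Real.sqrt ρ * X i k) := by
      rw [hEdec, Matrix.sub_mul, Matrix.sub_apply, Matrix.diagonal_mul]
      congr 1
      rw [Matrix.mul_apply, Matrix.mulVec, dotProduct, Finset.mul_sum]
      refine Finset.sum_congr rfl fun j _ => ?_
      simp only [hY, Matrix.of_apply]; ring
    rw [e1]
    refine (abs_sub _ _).trans ?_
    rw [abs_mul, abs_of_nonneg hsρ0]
    have h2 : |ρ * dotd (X i) (X i) * (Real.sqrt ρ * X i k)| ≤ B ^ 3 := by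
      rw [abs_mul, abs_mul, abs_mul, abs_of_nonneg hsρ0, abs_of_nonneg hρ0.le, abs_of_nonneg (hdot0 i)]
      have h3 := coord_le hB0.le (hX i) k
      calc ρ * dotd (X i) (X i) * (Real.sqrt ρ * |X i k|) ≤ 1 * B ^ 2 * (1 * B) := by
            gcongr
            · exact hdot0 i
            · exact hX i
        _ = B ^ 3 := by ring
    have h4 : 1 ≤ a * b := by nlinarith
    have h5 : B ^ 3 ≤ B ^ 3 * (a * b) := le_mul_of_one_le_right (by positivity) h4
    have h6 := hrow i k
    linarith
  have hab : a * b ≤ a * b ^ 2 := by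
    have := mul_le_mul_of_nonneg_left hb (mul_pos ha0 hb0).le
    calc a * b = a * b * 1 := by ring
      _ ≤ a * b * b := this
      _ = a * b ^ 2 := by ring
  have hT1 : euclNorm (Y i) * (δ * (‖Y‖ + δ)) ≤ B * (c3 * (B + c3)) * (a * b ^ 2) := by
    have h1 : euclNorm (Y i) ≤ B := (hYi i).trans (mul_le_of_le_one_left hB0.le hsρ1)
    have h2 : ‖Y‖ + δ ≤ (B + c3) * a := by nlinarith
    calc euclNorm (Y i) * (δ * (‖Y‖ + δ)) ≤ B * (c3 * b * ((B + c3) * a)) := by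
          gcongr
      _ = B * (c3 * (B + c3)) * (a * b) := by ring
      _ ≤ _ := by
          refine mul_le_mul_of_nonneg_left ?_ (by positivity)
          exact hab
  have hT2 : d * ((5 * B + B ^ 3) * (a * b)) ≤ d * (5 * B + B ^ 3) * (a * b ^ 2) := by
    rw [mul_assoc (d:ℝ)]
    refine mul_le_mul_of_nonneg_left (mul_le_mul_of_nonneg_left ?_ (by positivity)) (by positivity)
    exact hab
  have hT3 : c * a * b * δ ≤ c * c3 * (a * b ^ 2) := by
    calc c * a * b * δ ≤ c * a * b * (c3 * b) := by gcongr
      _ = _ := by ring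
  have hfin : κ / 2 * a ^ 2 * e ≤ (B * (c3 * (B + c3)) + d * (5 * B + B ^ 3) + c * c3) * (a * b ^ 2) := by
    have hh : κ * a ^ 2 / 2 * e = κ / 2 * a ^ 2 * e := by ring
    linarith
  rw [ccF, ← hc3, div_mul_div_comm, le_div_iff₀ (by positivity)]
  have : (e * (κ / 2 * a)) * a ≤ ((B * (c3 * (B + c3)) + d * (5 * B + B ^ 3) + c * c3) * b ^ 2) * a := by
    linarith
  exact le_of_mul_le_mul_right this ha0

end GoodDet

section MeasSide

lemma prod_bound {α β : Type*} [MeasurableSpace α] [MeasurableSpace β] (μ : Measure α) (ν : Measure β)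
    [SFinite μ] [IsProbabilityMeasure ν] {E : Set (α × β)} (hE : MeasurableSet E) (ε : ℝ≥0∞)
    (h : ∀ᵐ y ∂ν, μ ((fun x => (x, y)) ⁻¹' E) ≤ ε) : (μ.prod ν) E ≤ ε := by
  rw [Measure.prod_apply_symm hE]
  calc ∫⁻ y, μ ((fun x => (x, y)) ⁻¹' E) ∂ν ≤ ∫⁻ _y, ε ∂ν := lintegral_mono_ae h
    _ = ε := by simp

/-- the bad set of edge configurations -/
def Sbad {n d : ℕ} (ρ τ r : ℝ) (X : Fin n → Fin d → ℝ) : Set (Fin n × Fin n → Bool) :=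
  {ω | ¬ OpLe (Mx (pX ρ X) ω) τ} ∪
    ⋃ ik : Fin n × Fin d, {ω | r < |(Mx (pX ρ X) ω).mulVec (fun j => X j ik.2) ik.1|}

lemma cont_pX {n d : ℕ} (ρ : ℝ) (e : Fin n × Fin n) :
    Continuous fun X : Fin n → Fin d → ℝ => pX ρ X e := by
  unfold pX dotd; fun_prop

lemma cont_Mx {n d : ℕ} (ρ : ℝ) (ω : Fin n × Fin n → Bool) (i j : Fin n) :
    Continuous fun X : Fin n → Fin d → ℝ => Mx (pX ρ X) ω i j := by
  unfold Mx
  simp only [Matrix.of_apply]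
  by_cases h : i = j
  · simpa [h] using continuous_const
  · simp only [h, if_false]
    exact continuous_const.sub (cont_pX ρ _)

lemma cont_Mx_mulVec {n d : ℕ} (ρ : ℝ) (ω : Fin n × Fin n → Bool) 
    (v : (Fin n → Fin d → ℝ) → Fin n → ℝ) (hv : ∀ j, Continuous fun X => v X j) (i : Fin n) :
    Continuous fun X : Fin n → Fin d → ℝ => (Mx (pX ρ X) ω).mulVec (v X) i := by
  unfold Matrix.mulVec dotProduct
  exact continuous_finset_sum _ fun j _ => (cont_Mx ρ ω i j).mul (hv j)

lemma meas_Sbad {n d : ℕ} (ρ τ r : ℝ) (ω : Fin n × Fin n → Bool) :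
    MeasurableSet {X : Fin n → Fin d → ℝ | ω ∈ Sbad ρ τ r X} := by
  have h : {X : Fin n → Fin d → ℝ | ω ∈ Sbad ρ τ r X} =
      {X | OpLe (Mx (pX ρ X) ω) τ}ᶜ ∪ ⋃ ik : Fin n × Fin d,
        {X | r < |(Mx (pX ρ X) ω).mulVec (fun j => X j ik.2) ik.1|} := by
    ext X; simp [Sbad]
  rw [h]
  refine MeasurableSet.union (MeasurableSet.compl (IsClosed.measurableSet ?_))
    (MeasurableSet.iUnion fun ik => IsOpen.measurableSet ?_)
  · have : {X : Fin n → Fin d → ℝ | OpLe (Mx (pX ρ X) ω) τ} = ⋂ v : Fin n → ℝ,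
        {X | (Mx (pX ρ X) ω).mulVec v ⬝ᵥ (Mx (pX ρ X) ω).mulVec v ≤ τ ^ 2 * (v ⬝ᵥ v)} := by
      ext X; simp [OpLe]
    rw [this]
    refine isClosed_iInter fun v => isClosed_le ?_ continuous_const
    unfold dotProduct
    refine continuous_finset_sum _ fun i _ => ?_
    have := cont_Mx_mulVec (d := d) ρ ω (fun _ => v) (fun j => continuous_const) i
    exact this.mul this
  · refine isOpen_lt continuous_const (continuous_abs.comp ?_)
    exact cont_Mx_mulVec ρ ω (fun X j => X j ik.2) (fun j => by fun_prop) ik.1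

lemma meas_E {n d : ℕ} (ρ τ r : ℝ) :
    MeasurableSet {q : (Fin n × Fin n → ℝ) × (Fin n → Fin d → ℝ) |
      (fun e => decide (q.1 e < pX ρ q.2 e)) ∈ Sbad ρ τ r q.2} := by
  have h : {q : (Fin n × Fin n → ℝ) × (Fin n → Fin d → ℝ) |
      (fun e => decide (q.1 e < pX ρ q.2 e)) ∈ Sbad ρ τ r q.2} =
      ⋃ ω : Fin n × Fin n → Bool, ((⋂ e, {q : (Fin n × Fin n → ℝ) × (Fin n → Fin d → ℝ) | decide (q.1 e < pX ρ q.2 e) = ω e}) ∩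
        Prod.snd ⁻¹' {X | ω ∈ Sbad ρ τ r X}) := by
    ext q
    simp only [Set.mem_setOf_eq, Set.mem_iUnion, Set.mem_inter_iff, Set.mem_iInter, Set.mem_preimage]
    constructor
    · intro hq; exact ⟨_, fun e => rfl, hq⟩
    · rintro ⟨ω, h1, h2⟩
      have : (fun e => decide (q.1 e < pX ρ q.2 e)) = ω := funext h1
      rwa [this]
  rw [h]
  refine MeasurableSet.iUnion fun ω => MeasurableSet.inter (MeasurableSet.iInter fun e => ?_)
    (measurable_snd (meas_Sbad ρ τ r ω))
  have hlt : MeasurableSet {q : (Fin n × Fin n → ℝ) × (Fin n → Fin d → ℝ) | q.1 e < pX ρ q.2 e} := by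
    refine measurableSet_lt (by fun_prop) ?_
    exact (cont_pX ρ e).measurable.comp measurable_snd
  cases ω e with
  | true => simpa using hlt
  | false =>
    have := hlt.compl
    convert this using 1
    ext q; simp

lemma meas_adj {n d : ℕ} (ρ : ℝ) : Measurable
    (fun p : (Fin n × Fin n → ℝ) × (Fin n → Fin d → ℝ) => (adjOf ρ p.2 p.1, p.2)) := by
  refine Measurable.prodMk ?_ measurable_snd
  refine measurable_pi_lambda _ fun i => measurable_pi_lambda _ fun j => ?_
  unfold adjOf
  by_cases h : i = j
  · simp [h]
  · simp only [h, if_false]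
    refine Measurable.ite ?_ measurable_const measurable_const
    refine measurableSet_lt (by fun_prop) ?_
    unfold dotd; fun_prop

lemma pair_prob (n : ℕ) : IsProbabilityMeasure (pairUniform n) := by
  have : IsProbabilityMeasure (volume.restrict (Set.Icc (0:ℝ) 1)) := ⟨by simp⟩
  unfold pairUniform; infer_instance

lemma edge_prob {n d : ℕ} {ρ B L : ℝ} (X : Fin n → Fin d → ℝ) (hB : 1 ≤ B)
    (hX : ∀ i, dotd (X i) (X i) ≤ B ^ 2) (hρ0 : 0 < ρ)
    (hp : ∀ e, 0 ≤ pX ρ X e ∧ pX ρ X e ≤ 1) (hn : 0 < n) (hL : L = Real.log n) (hL1 : 1 ≤ L)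
    (hN : 2 * L ≤ ρ * n) :
    Pr (pX ρ X) (Sbad ρ (Real.sqrt (4 * Real.exp 7) * B * Real.sqrt (ρ * n) * Real.sqrt L)
      (5 * B * Real.sqrt (n * L)) X) ≤ (1 + 2 * d) / (n:ℝ) ^ 2 := by
  have hn' : (0:ℝ) < n := by exact_mod_cast hn
  have hLn : L ≤ n := by rw [hL]; exact Real.log_le_self hn'.le
  have hB0 : 0 < B := by linarith
  set Q : ℕ := ⌈L⌉₊ with hQ
  have hLQ : L ≤ Q := Nat.le_ceil L
  have hQL : (Q:ℝ) ≤ 2 * L := by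
    have := (Nat.ceil_lt_add_one (by linarith : 0 ≤ L)).le
    linarith
  have hQ0 : Q ≠ 0 := by
    intro h; rw [h] at hLQ; norm_num at hLQ; linarith
  have hdd : ∀ i j, dotd (X i) (X j) ≤ B ^ 2 := by
    intro i j
    have h1 := hX i
    have h2 := hX j
    have h3 : 2 * dotd (X i) (X j) ≤ dotd (X i) (X i) + dotd (X j) (X j) := by
      unfold dotd
      rw [Finset.mul_sum, ← Finset.sum_add_distrib]
      refine Finset.sum_le_sum fun k _ => ?_
      nlinarith [sq_nonneg (X i k - X j k)]
    linarith
  set m : ℝ := ρ * n * B ^ 2 with hm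
  have hB2 : 1 ≤ B ^ 2 := by nlinarith
  have hmN : ρ * n ≤ m := le_mul_of_one_le_right (by positivity) hB2
  have h1 := spec_prob hp (m := m) (fun i => by
    calc ∑ j ∈ Finset.univ.erase i, pX ρ X (edg i j)
        ≤ ∑ j : Fin n, ρ * B ^ 2 := by
          refine (Finset.sum_le_sum (g := fun _ => ρ * B ^ 2) fun j _ => ?_).trans
            (Finset.sum_le_sum_of_subset_of_nonneg (Finset.subset_univ _)
              fun _ _ _ => by positivity)
          rw [pX_edg]
          exact mul_le_mul_of_nonneg_left (hdd i j) hρ0.le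
      _ = m := by simp [hm]; ring) Q hQ0 (by positivity) (by linarith)
  have hτ : Real.sqrt (2 * Real.exp 7 * Q * m) ≤
      Real.sqrt (4 * Real.exp 7) * B * Real.sqrt (ρ * n) * Real.sqrt L := by
    rw [show Real.sqrt (4 * Real.exp 7) * B * Real.sqrt (ρ * n) * Real.sqrt L =
      Real.sqrt (4 * Real.exp 7 * B ^ 2 * (ρ * n) * L) by
        rw [Real.sqrt_mul (by positivity : 0 ≤ 4 * Real.exp 7 * B ^ 2 * (ρ * n)) L,
          Real.sqrt_mul (by positivity : 0 ≤ 4 * Real.exp 7 * B ^ 2) (ρ * n),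
          Real.sqrt_mul (by positivity : 0 ≤ 4 * Real.exp 7) (B ^ 2), Real.sqrt_sq hB0.le]]
    refine Real.sqrt_le_sqrt ?_
    calc 2 * Real.exp 7 * Q * m ≤ 2 * Real.exp 7 * (2 * L) * m := by gcongr
      _ = _ := by rw [hm]; ring
  have h1' : Pr (pX ρ X) {ω | ¬ OpLe (Mx (pX ρ X) ω)
      (Real.sqrt (4 * Real.exp 7) * B * Real.sqrt (ρ * n) * Real.sqrt L)} ≤
      n * Real.exp (-(4 * L)) := by
    refine (Pr_mono hp ?_).trans (h1.trans ?_)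
    · intro ω hω h
      exact hω (h.mono (Real.sqrt_nonneg _) hτ)
    · gcongr
  have h2 : Pr (pX ρ X) (⋃ ik : Fin n × Fin d, {ω | 5 * B * Real.sqrt (n * L) <
      |(Mx (pX ρ X) ω).mulVec (fun j => X j ik.2) ik.1|}) ≤ n * d * (2 * Real.exp (-(4 * L))) := by
    refine (Pr_iUnion_le hp _).trans ?_
    calc _ ≤ ∑ _ik : Fin n × Fin d, 2 * Real.exp (-(4 * L)) := Finset.sum_le_sum fun ik _ =>
          row_prob hp _ hB0 (fun j => coord_le hB0.le (hX j) _) (by linarith) hn hLn _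
      _ = _ := by simp
  refine (Pr_union_le hp _ _).trans ((add_le_add h1' h2).trans ?_)
  have hexp : Real.exp (-(4 * L)) = 1 / (n:ℝ) ^ 4 := by
    rw [Real.exp_neg, hL, show (4:ℝ) * Real.log n = ((4:ℕ):ℝ) * Real.log n by norm_num,
      Real.exp_nat_mul, Real.exp_log hn', one_div]
  rw [hexp]
  have hn1 : (1:ℝ) ≤ n := by exact_mod_cast hn
  rw [le_div_iff₀ (by positivity)]
  have : (n * (1 / (n:ℝ) ^ 4) + n * d * (2 * (1 / (n:ℝ) ^ 4))) * (n:ℝ) ^ 2 = (1 + 2 * d) * (1 / n) := by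
    field_simp
  rw [this]
  have : 1 / (n:ℝ) ≤ 1 := by rw [div_le_one hn']; exact hn1
  exact mul_le_of_le_one_right (by positivity) this

lemma large_n {n d : ℕ} (F : Measure (Fin d → ℝ)) [IsProbabilityMeasure F] {ρ B κ L ε : ℝ}
    (hdn : d ≤ n) (hn : 0 < n) (hρ0 : 0 < ρ) (hρ1 : ρ ≤ 1) (hB : 1 ≤ B) (hκ : 0 < κ)
    (hL : L = Real.log n) (hL1 : 1 ≤ L) (hN : 2 * L ≤ ρ * n)
    (hrange : ∀ x ∈ msupport F, ∀ y ∈ msupport F, 0 ≤ ρ * dotd x y ∧ ρ * dotd x y ≤ 1)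
    (hFB : ∀ x ∈ msupport F, dotd x x ≤ B ^ 2)
    (hgap : 4 * ((Real.sqrt (4 * Real.exp 7) * B + B ^ 2) * Real.sqrt L) ≤ κ * Real.sqrt (ρ * n))
    (hcov : (Measure.pi fun _ : Fin n => F) {X | ¬ ∀ v : Fin d → ℝ,
        κ * n * (v ⬝ᵥ v) ≤ (Matrix.of X).mulVec v ⬝ᵥ (Matrix.of X).mulVec v} ≤ ENNReal.ofReal ε) :
    ((pairUniform n).prod (Measure.pi fun _ : Fin n => F))
      {q | ¬ ∃ Q : Matrix (Fin d) (Fin d) ℝ, Qᵀ * Q = 1 ∧ ∀ i,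
        euclNorm ((Matrix.of (ase d (adjOf ρ q.2 q.1)) * Q -
          Matrix.of (fun i j => Real.sqrt ρ * q.2 i j)) i) ≤
          ccF d B κ (Real.sqrt (4 * Real.exp 7) * B + B ^ 2) * (L / Real.sqrt (ρ * n))} ≤
      ENNReal.ofReal ((1 + 2 * d) / (n:ℝ) ^ 2) + ENNReal.ofReal ε := by
  haveI := pair_prob n
  set νX := Measure.pi fun _ : Fin n => F with hν
  set τ := Real.sqrt (4 * Real.exp 7) * B * Real.sqrt (ρ * n) * Real.sqrt L with hτ
  set r := 5 * B * Real.sqrt (n * L) with hr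
  set E := {q : (Fin n × Fin n → ℝ) × (Fin n → Fin d → ℝ) |
      (fun e => decide (q.1 e < pX ρ q.2 e)) ∈ Sbad ρ τ r q.2} with hE
  set G := {X : Fin n → Fin d → ℝ | ¬ ∀ v : Fin d → ℝ,
        κ * n * (v ⬝ᵥ v) ≤ (Matrix.of X).mulVec v ⬝ᵥ (Matrix.of X).mulVec v} with hG
  set Z := {X : Fin n → Fin d → ℝ | ¬ ∀ i, X i ∈ msupport F} with hZ
  have hn' : (0:ℝ) < n := by exact_mod_cast hn
  have hae : ∀ᵐ X ∂νX, ∀ i, X i ∈ msupport F := pi_ae F (ae_msupport F)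
  have hZ0 : νX Z = 0 := hae
  have hsub : {q : (Fin n × Fin n → ℝ) × (Fin n → Fin d → ℝ) |
      ¬ ∃ Q : Matrix (Fin d) (Fin d) ℝ, Qᵀ * Q = 1 ∧ ∀ i,
        euclNorm ((Matrix.of (ase d (adjOf ρ q.2 q.1)) * Q -
          Matrix.of (fun i j => Real.sqrt ρ * q.2 i j)) i) ≤
          ccF d B κ (Real.sqrt (4 * Real.exp 7) * B + B ^ 2) * (L / Real.sqrt (ρ * n))} ⊆
      E ∪ (Set.univ ×ˢ G ∪ Set.univ ×ˢ Z) := by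
    intro q hq
    by_contra hcon
    apply hq
    simp only [Set.mem_union, Set.mem_prod, Set.mem_univ, true_and, not_or] at hcon
    obtain ⟨hqE, hqG, hqZ⟩ := hcon
    have hgram := not_not.1 hqG
    have hsupp := not_not.1 hqZ
    have hqE' : (fun e => decide (q.1 e < pX ρ q.2 e)) ∉ Sbad ρ τ r q.2 := hqE
    simp only [Sbad, Set.mem_union, Set.mem_iUnion, Set.mem_setOf_eq, not_or, not_not, not_exists,
      not_lt] at hqE'
    obtain ⟨hop, hrow⟩ := hqE'
    have hLs : Real.sqrt L ^ 2 = L := Real.sq_sqrt (by linarith)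
    have hNs : Real.sqrt (ρ * n) ^ 2 = ρ * n := Real.sq_sqrt (by positivity)
    have := good_det (a := Real.sqrt (ρ * n)) (b := Real.sqrt L)
      (c1 := Real.sqrt (4 * Real.exp 7) * B) hdn q.2 q.1 hρ0 hρ1 hB hκ (by positivity)
      (fun i => hFB _ (hsupp i)) hNs (by rw [Real.one_le_sqrt]; exact hL1)
      (Real.sqrt_le_sqrt (by linarith)) hgap hop (fun i k => by
        have h1 := mul_le_mul_of_nonneg_left (hrow (i, k)) (Real.sqrt_nonneg ρ)
        refine h1.trans (le_of_eq ?_)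
        rw [hr, Real.sqrt_mul hn'.le, Real.sqrt_mul hρ0.le]
        ring) hgram
    rw [hLs] at this
    exact this
  refine (measure_mono hsub).trans ((measure_union_le _ _).trans (add_le_add ?_ ?_))
  · refine prod_bound _ _ (meas_E ρ τ r) _ ?_
    filter_upwards [hae] with X hX
    have hp : ∀ e, 0 ≤ pX ρ X e ∧ pX ρ X e ≤ 1 := fun e => hrange _ (hX _) _ (hX _)
    refine (transfer hp (Sbad ρ τ r X)).trans (ENNReal.ofReal_le_ofReal ?_)
    exact edge_prob X hB (fun i => hFB _ (hX i)) hρ0 hp hn hL hL1 hN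
  · refine (measure_union_le _ _).trans ?_
    rw [Measure.prod_prod, Measure.prod_prod, hZ0, mul_zero, add_zero, measure_univ, one_mul]
    exact hcov

end MeasSide

/-- Lemma `sparse:2toinfty`: in the sparse setting with
`ρ_n n = ω(log n)`, with probability at least `1 − C n⁻²` there exists an orthogonal matrix
`Q` with `‖X̂Q − √ρ_n X‖_{2,∞} ≤ C log n / √(ρ_n n)`. -/
theorem sparse_two_to_infty_bound
    {d : ℕ} (F : Measure (Fin d → ℝ)) [IsProbabilityMeasure F]
    (ρ : ℕ → ℝ) (hρpos : ∀ n, 0 < ρ n) (hρ0 : Tendsto ρ atTop (𝓝 0))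
    (hdense : Tendsto (fun n : ℕ => ρ n * n / Real.log n) atTop atTop)
    (hρrange : ∀ᶠ n : ℕ in atTop, ∀ x ∈ msupport F, ∀ y ∈ msupport F,
      0 ≤ ρ n * dotd x y ∧ ρ n * dotd x y ≤ 1)
    (hrank : (secondMoment F).det ≠ 0) :
    ∃ C : ℝ, 0 < C ∧ ∀ n : ℕ,
      ENNReal.ofReal (1 - C / (n : ℝ) ^ 2) ≤
        rdpgLawOf (ρ n) (Measure.pi fun _ : Fin n => F)
          {p | ∃ Q : Matrix (Fin d) (Fin d) ℝ, Qᵀ * Q = 1 ∧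
            twoInftyNorm (Matrix.of (ase d p.1) * Q -
                Matrix.of fun i j => Real.sqrt (ρ n) * p.2 i j) ≤
              C * Real.log n / Real.sqrt (ρ n * n)} := by
  obtain ⟨n0, hn0⟩ := hρrange.exists
  have hr0 := hρpos n0
  set B : ℝ := 1 + 1 / ρ n0 with hBdef
  have hB : 1 ≤ B := by
    have : 0 < 1 / ρ n0 := by positivity
    rw [hBdef]; linarith
  have hFB : ∀ x ∈ msupport F, dotd x x ≤ B ^ 2 := by
    intro x hx
    have h1 := (hn0 x hx x hx).2
    have h2 : dotd x x ≤ 1 / ρ n0 := by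
      rw [le_div_iff₀ hr0]; linarith
    have h3 : B ≤ B ^ 2 := by nlinarith
    have h4 : 1 / ρ n0 ≤ B := by rw [hBdef]; linarith
    linarith
  obtain ⟨κ, hκ, c, hc, hcov⟩ := cov_prob F (by linarith : 0 < B)
    ((ae_msupport F).mono hFB) hrank
  set c2 : ℝ := Real.sqrt (4 * Real.exp 7) * B + B ^ 2 with hc2
  have hev : ∀ᶠ n : ℕ in atTop, d ≤ n ∧ 0 < n ∧ ρ n ≤ 1 ∧ 1 ≤ Real.log n ∧
      max 2 ((4 * c2 / κ) ^ 2) ≤ ρ n * n / Real.log n ∧ (∀ x ∈ msupport F, ∀ y ∈ msupport F,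
      0 ≤ ρ n * dotd x y ∧ ρ n * dotd x y ≤ 1) := by
    filter_upwards [eventually_ge_atTop d, eventually_gt_atTop 0,
      hρ0.eventually (eventually_le_nhds (by norm_num : (0:ℝ) < 1)),
      (Real.tendsto_log_atTop.comp tendsto_natCast_atTop_atTop).eventually_ge_atTop 1,
      hdense.eventually_ge_atTop (max 2 ((4 * c2 / κ) ^ 2)), hρrange] with n h1 h2 h3 h4 h5 h6
    exact ⟨h1, h2, h3, h4, h5, h6⟩
  obtain ⟨N0, hN0⟩ := eventually_atTop.1 hev
  set C : ℝ := |ccF d B κ c2| + (N0:ℝ) ^ 2 + 1 + (1 + 2 * d) + 4 * d ^ 2 / c ^ 2 with hC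
  have hCpos : 0 < C := by positivity
  refine ⟨C, hCpos, fun n => ?_⟩
  haveI := pair_prob n
  unfold rdpgLawOf
  refine le_trans ?_ (Measure.le_map_apply (meas_adj (ρ n)).aemeasurable _)
  rcases Nat.eq_zero_or_pos n with hn | hn
  · subst hn
    refine le_trans ?_ (measure_mono (s := Set.univ) fun q _ => ?_)
    · rw [measure_univ]
      simp
    · refine ⟨1, by simp, ?_⟩
      simp [twoInftyNorm]
  have hn' : (0:ℝ) < n := by exact_mod_cast hn
  rcases lt_or_ge n N0 with hlt | hge
  · have h1 : (n:ℝ) ^ 2 ≤ C := by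
      have h2 : (n:ℝ) ≤ N0 := by exact_mod_cast hlt.le
      have h3 : (n:ℝ) ^ 2 ≤ (N0:ℝ) ^ 2 := pow_le_pow_left₀ hn'.le h2 2
      have h4 : 0 ≤ |ccF d B κ c2| + 1 + (1 + 2 * d) + 4 * d ^ 2 / c ^ 2 := by positivity
      rw [hC]; linarith
    have h2 : 1 - C / (n:ℝ) ^ 2 ≤ 0 := by
      rw [sub_nonpos, le_div_iff₀ (by positivity)]; linarith
    rw [ENNReal.ofReal_of_nonpos h2]
    exact bot_le
  obtain ⟨hdn, -, hρ1, hL1, hN, hrange⟩ := hN0 n hge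
  have hL0 : 0 < Real.log n := by linarith
  rw [le_div_iff₀ hL0] at hN
  have hρn := hρpos n
  have hN2 : 2 * Real.log n ≤ ρ n * n :=
    le_trans (mul_le_mul_of_nonneg_right (le_max_left _ _) hL0.le) hN
  have hN3 : (4 * c2 / κ) ^ 2 * Real.log n ≤ ρ n * n :=
    le_trans (mul_le_mul_of_nonneg_right (le_max_right _ _) hL0.le) hN
  have hc20 : 0 ≤ c2 := by positivity
  have hgap : 4 * (c2 * Real.sqrt (Real.log n)) ≤ κ * Real.sqrt (ρ n * n) := by
    have h1 := Real.sqrt_le_sqrt hN3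
    rw [Real.sqrt_mul (by positivity), Real.sqrt_sq (by positivity), div_mul_eq_mul_div,
      div_le_iff₀ hκ] at h1
    linarith
  have hlarge := large_n F hdn hn hρn hρ1 hB hκ rfl hL1 hN2 hrange hFB hgap (hcov n)
  set μ := (pairUniform n).prod (Measure.pi fun _ : Fin n => F) with hμ
  set T := {q : (Fin n × Fin n → ℝ) × (Fin n → Fin d → ℝ) |
    ∃ Q : Matrix (Fin d) (Fin d) ℝ, Qᵀ * Q = 1 ∧ ∀ i,
        euclNorm ((Matrix.of (ase d (adjOf (ρ n) q.2 q.1)) * Q -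
          Matrix.of (fun i j => Real.sqrt (ρ n) * q.2 i j)) i) ≤
          ccF d B κ c2 * (Real.log n / Real.sqrt (ρ n * n))} with hT
  have hTc : μ Tᶜ ≤ ENNReal.ofReal (C / (n:ℝ) ^ 2) := by
    refine hlarge.trans ?_
    rw [← ENNReal.ofReal_add (by positivity) (by positivity)]
    refine ENNReal.ofReal_le_ofReal ?_
    have hx : Real.exp (-(c * n)) ≤ 2 / (c * n) ^ 2 := by
      have h1 := Real.quadratic_le_exp_of_nonneg (x := c * n) (by positivity)
      have h2 : (c * n) ^ 2 / 2 ≤ Real.exp (c * n) := by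
        have : 0 ≤ c * n := by positivity
        linarith
      rw [Real.exp_neg, inv_le_comm₀ (Real.exp_pos _) (by positivity), inv_div]
      exact h2
    have h3 : 2 * (d:ℝ) ^ 2 * Real.exp (-(c * n)) ≤ (4 * d ^ 2 / c ^ 2) / (n:ℝ) ^ 2 := by
      calc 2 * (d:ℝ) ^ 2 * Real.exp (-(c * n)) ≤ 2 * (d:ℝ) ^ 2 * (2 / (c * n) ^ 2) := by gcongr
        _ = _ := by field_simp; ring
    calc (1 + 2 * (d:ℝ)) / (n:ℝ) ^ 2 + 2 * (d:ℝ) ^ 2 * Real.exp (-(c * n))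
        ≤ (1 + 2 * (d:ℝ)) / (n:ℝ) ^ 2 + (4 * d ^ 2 / c ^ 2) / (n:ℝ) ^ 2 := by gcongr
      _ = ((1 + 2 * (d:ℝ)) + 4 * d ^ 2 / c ^ 2) / (n:ℝ) ^ 2 := by ring
      _ ≤ C / (n:ℝ) ^ 2 := by
        gcongr
        have h4 : 0 ≤ |ccF d B κ c2| + (N0:ℝ) ^ 2 + 1 := by positivity
        rw [hC]; linarith
  have hsub : T ⊆ (fun p : (Fin n × Fin n → ℝ) × (Fin n → Fin d → ℝ) =>
      (adjOf (ρ n) p.2 p.1, p.2)) ⁻¹' {p | ∃ Q : Matrix (Fin d) (Fin d) ℝ, Qᵀ * Q = 1 ∧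
            twoInftyNorm (Matrix.of (ase d p.1) * Q -
                Matrix.of fun i j => Real.sqrt (ρ n) * p.2 i j) ≤
              C * Real.log n / Real.sqrt (ρ n * n)} := by
    rintro q ⟨Q, hQ, hq⟩
    refine ⟨Q, hQ, ?_⟩
    haveI : Nonempty (Fin n) := ⟨⟨0, hn⟩⟩
    refine ciSup_le fun i => (hq i).trans ?_
    rw [mul_div_assoc]
    refine mul_le_mul_of_nonneg_right ?_ (by positivity)
    have h4 : 0 ≤ (N0:ℝ) ^ 2 + 1 + (1 + 2 * d) + 4 * d ^ 2 / c ^ 2 := by positivity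
    have h5 := le_abs_self (ccF d B κ c2)
    rw [hC]; linarith
  refine le_trans ?_ (measure_mono hsub)
  rw [ENNReal.ofReal_sub _ (by positivity), ENNReal.ofReal_one, tsub_le_iff_right]
  calc (1:ℝ≥0∞) = μ (T ∪ Tᶜ) := by rw [Set.union_compl_self, measure_univ]
    _ ≤ μ T + μ Tᶜ := measure_union_le _ _
    _ ≤ _ := by gcongr

end
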